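/- arXiv:2603.14746 — 8 statements merged into one kernel-verified Lean document; each statement's English description precedes it below -/
import Mathlib

section
/- Let G = (I, J, {A_i}, {B_j}, μ, V) be a projection game with projection functions p_{i,j}. For each i ∈ I let Ã_i ⊆ A_i be a set of representatives for the partition of A_i induced by p_i (i.e. for every a ∈ A_i there is a unique ã ∈ Ã_i with p_i(ã) = p_i(a)), and let G̃ = (I, J, {Ã_i}, {B_j}, μ, Ṽ) where Ṽ is the restriction of V. Then: (1) G̃ is a non-degenerate projection game; and (2) for every correlation c for G, the function c̃ defined for a ∈ Ã_i by c̃(a,b|i,j) = Σ_{a' ∈ A_i : p_i(a') = p_i(a)} c(a',b|i,j) is a correlation for G̃ and satisfies w_{G̃}(c̃) = w_G(c). -/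
open scoped Classical

/-- If every point is related to exactly one representative in `T`, then summing over `T` the sums
over the classes of the representatives gives the sum over all points. -/
theorem sum_representatives_sum_ite {α M : Type*} [Fintype α] [AddCommMonoid M] {T : Finset α}
    {R : α → α → Prop} [DecidableRel R] (hT : ∀ a, ∃! t, t ∈ T ∧ R a t)
    {f : α → α → M} {g : α → M} (hfg : ∀ t ∈ T, ∀ a, R a t → f t a = g a) :
    (∑ t ∈ T, ∑ a, if R a t then f t a else 0) = ∑ a, g a := by
  rw [Finset.sum_comm]
  refine Finset.sum_congr rfl fun a _ => ?_
  obtain ⟨t, ⟨htT, hat⟩, huniq⟩ := hT a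
  rw [Finset.sum_eq_single_of_mem t htT, if_pos hat, hfg t htT a hat]
  exact fun s hs hst => if_neg fun has => hst (huniq s ⟨hs, has⟩)

/-- Let `G` be a projection game with question sets `I, J`, answer sets
`A i, B j`, question distribution `μ`, and projection functions `p i j : A i → B j`
(so that `V(a,b|i,j) = 1` iff `b = p i j a`).  For each `i`, let `T i ⊆ A i` be a set of
representatives for the partition of `A i` induced by `p_i = (p i j)_{j : μ i j > 0}`,
and let `G̃` be the restricted game.  Then `G̃` is a non-degenerate projection game, and
for every correlation `c` for `G`, the function
`c̃(a,b|i,j) = ∑_{a' : p_i a' = p_i a} c(a',b|i,j)` (for `a ∈ T i`) is a correlation for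
`G̃` with `w_{G̃}(c̃) = w_G(c)`. -/
theorem projection_game_nondegenerate_restriction_forward
    {I J : Type} [Fintype I] [Fintype J] [Nonempty I] [Nonempty J]
    {A : I → Type} [∀ i, Fintype (A i)] [∀ i, Nonempty (A i)]
    {B : J → Type} [∀ j, Fintype (B j)] [∀ j, Nonempty (B j)]
    (μ : I → J → ℝ) (hμ0 : ∀ i j, 0 ≤ μ i j) (hμ1 : ∑ i, ∑ j, μ i j = 1)
    (p : ∀ i j, A i → B j)
    -- `T i` is a set of representatives for the partition of `A i` induced by `p_i`
    (T : ∀ i, Finset (A i))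
    (hT : ∀ i (a : A i), ∃! a0, a0 ∈ T i ∧ ∀ j, 0 < μ i j → p i j a0 = p i j a)
    -- `c` is a correlation for `G`
    (c : ∀ i j, A i → B j → ℝ)
    (hc0 : ∀ i j (a : A i) (b : B j), 0 ≤ c i j a b)
    (hc1 : ∀ i j, ∑ a : A i, ∑ b : B j, c i j a b = 1) :
    -- (1) `G̃` is a non-degenerate projection game
    (∀ i, ∀ a ∈ T i, ∀ a' ∈ T i, (∀ j, 0 < μ i j → p i j a = p i j a') → a = a') ∧
    -- (2a) `c̃` is nonnegative
    (∀ i j (a : A i) (b : B j),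
      0 ≤ ∑ a' : A i, if (∀ j', 0 < μ i j' → p i j' a' = p i j' a) then c i j a' b else 0) ∧
    -- (2b) `c̃(·,·|i,j)` is a probability distribution on `T i × B j`
    (∀ i j, ∑ a ∈ T i, ∑ b : B j,
      (∑ a' : A i, if (∀ j', 0 < μ i j' → p i j' a' = p i j' a) then c i j a' b else 0) = 1) ∧
    -- (2c) the winning probabilities agree: `w_{G̃}(c̃) = w_G(c)`
    (∑ i, ∑ j, μ i j * ∑ a ∈ T i,
        (∑ a' : A i, if (∀ j', 0 < μ i j' → p i j' a' = p i j' a)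
          then c i j a' (p i j a) else 0))
      = ∑ i, ∑ j, μ i j * ∑ a : A i, c i j a (p i j a) := by
  have hR : ∀ i (a : A i), ∃! t, t ∈ T i ∧ ∀ j, 0 < μ i j → p i j a = p i j t := by
    simpa only [eq_comm] using hT
  refine ⟨fun i a ha a' ha' h => ?_, fun i j a b => ?_, fun i j => ?_, ?_⟩
  · exact (hT i a').unique ⟨ha, h⟩ ⟨ha', fun _ _ => rfl⟩
  · refine Finset.sum_nonneg fun a' _ => ?_
    split_ifs
    exacts [hc0 i j a' b, le_rfl]
  · rw [Finset.sum_comm, ← hc1 i j, Finset.sum_comm (s := Finset.univ (α := A i))]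
    exact Finset.sum_congr rfl fun b _ =>
      sum_representatives_sum_ite (hR i) fun _ _ _ _ => rfl
  · refine Finset.sum_congr rfl fun i _ => Finset.sum_congr rfl fun j _ => ?_
    rcases (hμ0 i j).eq_or_lt with h | h
    · simp [← h]
    · congr 1
      exact sum_representatives_sum_ite (hR i) fun t _ a hat => by rw [hat j h]
end

section
/- Let c be a quantum correlation, i.e. there exist finite-dimensional complex Hilbert spaces H_A, H_B, POVMs {A^i_a}_{a∈A_i} on H_A and {B^j_b}_{b∈B_j} on H_B, and a unit vector ψ ∈ H_A ⊗ H_B with c(a,b|i,j) = ⟨ψ, (A^i_a ⊗ B^j_b) ψ⟩. Then there exist d ≥ 1, POVMs {P^i_a}_{a∈A_i} and {Q^j_b}_{b∈B_j} of positive semidefinite d × d complex matrices summing to the identity, and real numbers λ_1, …, λ_d > 0 with Σ_n λ_n² = 1, such that with φ = Σ_{n=1}^d λ_n e_n ⊗ e_n ∈ ℂ^d ⊗ ℂ^d (e_n the standard basis), c(a,b|i,j) = ⟨φ, (P^i_a ⊗ Q^j_b) φ⟩ for all i, j, a, b. -/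
open scoped ComplexOrder Kronecker Matrix

/-- The compact singular value decomposition: `M = U * diagonal lam * Vᵀ` with positive singular
values and `U`, `V` having orthonormal columns. -/
theorem Matrix.exists_isometries_diagonal_factorization {m n : Type*} [Fintype m] [Fintype n]
    [DecidableEq m] (M : Matrix m n ℂ) :
    ∃ (d : ℕ) (U : Matrix m (Fin d) ℂ) (V : Matrix n (Fin d) ℂ) (lam : Fin d → ℝ),
      Uᴴ * U = 1 ∧ Vᴴ * V = 1 ∧ (∀ k, 0 < lam k) ∧
      M = U * Matrix.diagonal (fun k => (lam k : ℂ)) * Vᵀ := by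
  have hpsd : (M * Mᴴ).PosSemidef := Matrix.posSemidef_self_mul_conjTranspose M
  set W : Matrix m m ℂ := (hpsd.1.eigenvectorUnitary).1 with hW
  set μ : m → ℝ := hpsd.1.eigenvalues with hμ
  have hμ0 : ∀ k, 0 ≤ μ k := hpsd.eigenvalues_nonneg
  have hWW : Wᴴ * W = 1 := Unitary.coe_star_mul_self hpsd.1.eigenvectorUnitary
  have hWW' : W * Wᴴ = 1 := Unitary.coe_mul_star_self hpsd.1.eigenvectorUnitary
  have hdiag : Wᴴ * (M * Mᴴ) * W = Matrix.diagonal (fun k => (μ k : ℂ)) := by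
    have h := hpsd.1.conjStarAlgAut_star_eigenvectorUnitary
    rw [Unitary.conjStarAlgAut_star_apply] at h
    exact h
  set N : Matrix m n ℂ := Wᴴ * M with hN
  have hNN : N * Nᴴ = Matrix.diagonal (fun k => (μ k : ℂ)) := by
    rw [← hdiag, hN, Matrix.conjTranspose_mul, Matrix.conjTranspose_conjTranspose]
    simp only [Matrix.mul_assoc]
  have hMN : M = W * N := by rw [hN, ← Matrix.mul_assoc, hWW', Matrix.one_mul]
  have hrow : ∀ k, μ k = 0 → ∀ b, N k b = 0 := by
    intro k hk b
    have h : N k ⬝ᵥ star (N k) = 0 := by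
      have := congrFun (congrFun hNN k) k
      rw [Matrix.diagonal_apply_eq, hk] at this
      simpa [Matrix.mul_apply, dotProduct] using this
    exact congrFun (dotProduct_self_star_eq_zero.mp h) b
  let e : Fin (Fintype.card {k // μ k ≠ 0}) ≃ {k // μ k ≠ 0} := (Fintype.equivFin _).symm
  have hpos : ∀ k, 0 < √(μ (e k)) := fun k =>
    Real.sqrt_pos.mpr (lt_of_le_of_ne (hμ0 _) (e k).2.symm)
  have hinj : ∀ k l, ((e k : m) = e l) ↔ k = l := fun k l => by
    rw [← Subtype.ext_iff, e.apply_eq_iff_eq]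
  refine ⟨_, Matrix.of fun a k => W a (e k), Matrix.of fun b k => N (e k) b / (√(μ (e k)) : ℂ),
    fun k => √(μ (e k)), ?_, ?_, hpos, ?_⟩
  · ext k l
    have h := congrFun (congrFun hWW (e k)) (e l)
    simp only [Matrix.mul_apply, Matrix.conjTranspose_apply, Matrix.one_apply, hinj] at h
    simpa [Matrix.mul_apply, Matrix.one_apply] using h
  · ext k l
    have h := congrFun (congrFun hNN (e l)) (e k)
    simp only [Matrix.mul_apply, Matrix.conjTranspose_apply, Matrix.diagonal_apply, hinj] at h
    have hk : (√(μ (e k)) : ℂ) ≠ 0 := Complex.ofReal_ne_zero.mpr (hpos k).ne'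
    calc _ = (∑ b, N (e l) b * star (N (e k) b)) / ((√(μ (e k)) : ℂ) * √(μ (e l))) := by
          rw [Finset.sum_div, Matrix.mul_apply]
          refine Finset.sum_congr rfl fun b _ => ?_
          simp only [Matrix.conjTranspose_apply, Matrix.of_apply, star_div₀, Complex.star_def,
            Complex.conj_ofReal]
          rw [div_mul_div_comm, mul_comm (N (e l) b)]
      _ = _ := by
          rw [h]
          by_cases hkl : k = l
          · subst hkl
            rw [if_pos rfl, Matrix.one_apply_eq, ← Complex.ofReal_mul,
              Real.mul_self_sqrt (hμ0 _), div_self (Complex.ofReal_ne_zero.mpr (e k).2)]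
          · rw [if_neg (Ne.symm hkl), zero_div, Matrix.one_apply_ne hkl]
  · ext a b
    rw [Matrix.mul_apply]
    simp only [Matrix.mul_diagonal, Matrix.of_apply, Matrix.transpose_apply]
    have h1 : ∀ k, W a (e k) * (√(μ (e k)) : ℂ) * (N (e k) b / (√(μ (e k)) : ℂ))
        = W a (e k) * N (e k) b := fun k => by
      have hk : (√(μ (e k)) : ℂ) ≠ 0 := Complex.ofReal_ne_zero.mpr (hpos k).ne'
      field_simp
    rw [Finset.sum_congr rfl fun k _ => h1 k,
      e.sum_comp (fun k : {k // μ k ≠ 0} => W a k * N k b), hMN, Matrix.mul_apply]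
    rw [← Finset.sum_subtype (Finset.univ.filter fun k => μ k ≠ 0) (by simp)
      (fun k => W a k * N k b)]
    symm
    refine Finset.sum_filter_of_ne ?_
    intro k _ hk h0
    exact hk (by rw [hrow k h0, mul_zero])

/-- The vector `∑ k, lam k • (U eₖ ⊗ V eₖ)` has the entries of `U * diagonal lam * Vᵀ`. -/
theorem Matrix.kronecker_mulVec_diagonal_apply {m n k : Type*} [Fintype k] [DecidableEq k]
    (U : Matrix m k ℂ) (V : Matrix n k ℂ) (lam : k → ℂ) (p : m × n) :
    ((U ⊗ₖ V) *ᵥ fun x : k × k => if x.1 = x.2 then lam x.1 else 0) p =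
      (U * Matrix.diagonal lam * Vᵀ) p.1 p.2 := by
  rw [Matrix.mul_apply]
  simp [Matrix.mulVec, dotProduct, Fintype.sum_prod_type, mul_right_comm]

/-- Conjugating the operator by `T` moves `T` out of the vectors of a quadratic form. -/
theorem Matrix.star_mulVec_dotProduct_mulVec {m k : Type*} [Fintype m] [Fintype k]
    (T : Matrix m k ℂ) (X : Matrix m m ℂ) (v : k → ℂ) :
    star (T *ᵥ v) ⬝ᵥ (X *ᵥ (T *ᵥ v)) = star v ⬝ᵥ ((Tᴴ * X * T) *ᵥ v) := by
  rw [Matrix.star_mulVec, ← Matrix.dotProduct_mulVec, Matrix.mulVec_mulVec, Matrix.mulVec_mulVec,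
    Matrix.mul_assoc]

theorem Matrix.sum_conjTranspose_mul_mul_eq_one {m k ι : Type*} [Fintype m] [DecidableEq m]
    [DecidableEq k] [Fintype ι] (U : Matrix m k ℂ) (hU : Uᴴ * U = 1) (X : ι → Matrix m m ℂ)
    (hX : ∑ a, X a = 1) : ∑ a, Uᴴ * X a * U = 1 := by
  rw [← Matrix.sum_mul, ← Matrix.mul_sum, hX, Matrix.mul_one, hU]

/-- Every quantum correlation (given by POVMs on finite-dimensional
Hilbert spaces and a unit vector in their tensor product) can be realized in "Schmidt
form": on `ℂ^d ⊗ ℂ^d` with state `φ = ∑ₙ λₙ eₙ ⊗ eₙ`, `λₙ > 0`, `∑ₙ λₙ² = 1`. -/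
theorem quantum_correlation_schmidt_form
    {I J : Type} [Fintype I] [Fintype J] [Nonempty I] [Nonempty J]
    {A : I → Type} [∀ i, Fintype (A i)] [∀ i, Nonempty (A i)]
    {B : J → Type} [∀ j, Fintype (B j)] [∀ j, Nonempty (B j)]
    (c : ∀ i j, A i → B j → ℝ)
    {dA dB : ℕ}
    (AP : ∀ i, A i → Matrix (Fin dA) (Fin dA) ℂ)
    (BQ : ∀ j, B j → Matrix (Fin dB) (Fin dB) ℂ)
    (hAP : ∀ i a, (AP i a).PosSemidef) (hAPsum : ∀ i, ∑ a, AP i a = 1)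
    (hBQ : ∀ j b, (BQ j b).PosSemidef) (hBQsum : ∀ j, ∑ b, BQ j b = 1)
    (ψ : Fin dA × Fin dB → ℂ) (hψ : star ψ ⬝ᵥ ψ = 1)
    (hc : ∀ i j a b, (c i j a b : ℂ) = star ψ ⬝ᵥ ((AP i a ⊗ₖ BQ j b) *ᵥ ψ)) :
    ∃ (d : ℕ) (P : ∀ i, A i → Matrix (Fin d) (Fin d) ℂ)
      (Q : ∀ j, B j → Matrix (Fin d) (Fin d) ℂ) (lam : Fin d → ℝ),
      1 ≤ d ∧
      (∀ i a, (P i a).PosSemidef) ∧ (∀ i, ∑ a, P i a = 1) ∧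
      (∀ j b, (Q j b).PosSemidef) ∧ (∀ j, ∑ b, Q j b = 1) ∧
      (∀ n, 0 < lam n) ∧ (∑ n, lam n ^ 2 = 1) ∧
      (∀ i j a b, (c i j a b : ℂ) =
        star (fun nm : Fin d × Fin d => if nm.1 = nm.2 then (lam nm.1 : ℂ) else 0) ⬝ᵥ
          ((P i a ⊗ₖ Q j b) *ᵥ
            fun nm : Fin d × Fin d => if nm.1 = nm.2 then (lam nm.1 : ℂ) else 0)) := by
  obtain ⟨d, U, V, lam, hU, hV, hlam, hM⟩ :=
    Matrix.exists_isometries_diagonal_factorization (Matrix.of fun a b => ψ (a, b))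
  set φ : Fin d × Fin d → ℂ := fun nm => if nm.1 = nm.2 then (lam nm.1 : ℂ) else 0 with hφ
  have hψφ : ψ = (U ⊗ₖ V) *ᵥ φ := by
    ext p
    rw [Matrix.kronecker_mulVec_diagonal_apply U V (fun k => (lam k : ℂ)), ← hM]
    rfl
  have hcorr : ∀ X Y, star ψ ⬝ᵥ ((X ⊗ₖ Y) *ᵥ ψ) =
      star φ ⬝ᵥ (((Uᴴ * X * U) ⊗ₖ (Vᴴ * Y * V)) *ᵥ φ) := by
    intro X Y
    rw [hψφ, Matrix.star_mulVec_dotProduct_mulVec, Matrix.conjTranspose_kronecker,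
      Matrix.mul_kronecker_mul, Matrix.mul_kronecker_mul]
  have hsum : ∑ n, lam n ^ 2 = 1 := by
    have h := hcorr 1 1
    rw [Matrix.one_kronecker_one, Matrix.one_mulVec, hψ, Matrix.mul_one, Matrix.mul_one, hU, hV,
      Matrix.one_kronecker_one, Matrix.one_mulVec] at h
    have h2 : star φ ⬝ᵥ φ = ((∑ n, lam n ^ 2 : ℝ) : ℂ) := by
      simp [hφ, dotProduct, Fintype.sum_prod_type, apply_ite, pow_two]
    rw [h2] at h
    exact_mod_cast h.symm
  refine ⟨d, fun i a => Uᴴ * AP i a * U, fun j b => Vᴴ * BQ j b * V, lam, ?_,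
    fun i a => (hAP i a).conjTranspose_mul_mul_same U,
    fun i => Matrix.sum_conjTranspose_mul_mul_eq_one U hU _ (hAPsum i),
    fun j b => (hBQ j b).conjTranspose_mul_mul_same V,
    fun j => Matrix.sum_conjTranspose_mul_mul_eq_one V hV _ (hBQsum j),
    hlam, hsum, fun i j a b => (hc i j a b).trans (hcorr _ _)⟩
  rcases Nat.eq_zero_or_pos d with rfl | hd
  · simp at hsum
  · exact hd
end

section
/- Let H be a complex Hilbert space, let I_1, …, I_n be finite sets, and let {A_𝐢}_{𝐢 ∈ I_1 × ⋯ × I_n} be a POVM of bounded operators on H (each A_𝐢 positive, Σ_𝐢 A_𝐢 = 1) such that each marginal {A^j_i}_{i ∈ I_j}, where A^j_i = Σ_{𝐢 : i_j = i} A_𝐢, is a PVM (each A^j_i is an orthogonal projection). Then A_𝐢 = A^1_{i_1} A^2_{i_2} ⋯ A^n_{i_n} for every 𝐢 ∈ I_1 × ⋯ × I_n, and {A_𝐢}_𝐢 is a PVM (each A_𝐢 is an orthogonal projection). -/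
/-- If `{A k}` is a finite family of positive operators summing to `1` and the operator
`P = ∑_{k ∈ S} A k` is a projection, then `P * A k` is `A k` for `k ∈ S` and `0` otherwise. -/
theorem coarse_graining_mul_of_isStarProjection
    {H K : Type*} [NormedAddCommGroup H] [InnerProductSpace ℂ H] [CompleteSpace H] [Fintype K]
    {A : K → (H →L[ℂ] H)} (hpos : ∀ k, 0 ≤ A k) (hsum : ∑ k, A k = 1)
    (S : K → Prop) [DecidablePred S]
    (hP : IsStarProjection (∑ k, if S k then A k else 0)) (k : K) :
    (∑ l, if S l then A l else 0) * A k = if S k then A k else 0 := by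
  have hcompl : 1 - (∑ l, if S l then A l else 0) = ∑ l, if S l then 0 else A l := by
    rw [← hsum, ← Finset.sum_sub_distrib]
    exact Finset.sum_congr rfl fun l _ => by split_ifs <;> simp
  by_cases hk : S k
  · have hle : A k ≤ ∑ l, if S l then A l else 0 := by
      have h := Finset.single_le_sum (f := fun l => if S l then A l else 0)
        (fun l _ => by split_ifs; exacts [hpos l, le_rfl]) (Finset.mem_univ k)
      simpa [hk] using h
    rw [if_pos hk]
    exact (hP.mul_right_and_mul_left_of_nonneg_of_le (hpos k) hle).2
  · have hle : A k ≤ 1 - ∑ l, if S l then A l else 0 := by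
      rw [hcompl]
      have h := Finset.single_le_sum (f := fun l => if S l then 0 else A l)
        (fun l _ => by split_ifs; exacts [le_rfl, hpos l]) (Finset.mem_univ k)
      simpa [hk] using h
    have h := (hP.one_sub.mul_right_and_mul_left_of_nonneg_of_le (hpos k) hle).2
    rw [if_neg hk]
    rwa [sub_mul, one_mul, sub_eq_self] at h

/-- If each factor either fixes `a` under left multiplication or annihilates it, then so does
their product. -/
theorem List.prod_map_mul_eq_ite {R J : Type*} [MonoidWithZero R] (f : J → R) (a : R)
    (p : J → Prop) [DecidablePred p] (l : List J)
    (h : ∀ j ∈ l, f j * a = if p j then a else 0) :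
    (l.map f).prod * a = if ∀ j ∈ l, p j then a else 0 := by
  induction l with
  | nil => simp
  | cons j l ih =>
    rw [List.map_cons, List.prod_cons, mul_assoc,
      ih fun i hi => h i (List.mem_cons_of_mem _ hi)]
    have hj := h j List.mem_cons_self
    by_cases hl : ∀ i ∈ l, p i <;> by_cases hpj : p j <;> simp_all

/-- Let `{A 𝐢}_{𝐢 ∈ I₁ × ⋯ × Iₙ}` be a POVM of bounded operators on a
complex Hilbert space `H` all of whose marginals `A^j_i = ∑_{𝐢 : 𝐢 j = i} A 𝐢` are PVMs
(orthogonal projections).  Then `A 𝐢 = A^1_{𝐢 1} ⋯ A^n_{𝐢 n}` for every `𝐢`, and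
`{A 𝐢}` is a PVM. -/
theorem joint_measurement_of_pvm_marginals_is_pvm
    {H : Type} [NormedAddCommGroup H] [InnerProductSpace ℂ H] [CompleteSpace H]
    {n : ℕ} {I : Fin n → Type} [∀ j, Fintype (I j)] [∀ j, DecidableEq (I j)]
    (A : (∀ j, I j) → (H →L[ℂ] H))
    (hpos : ∀ ii, (A ii).IsPositive)
    (hsum : ∑ ii, A ii = 1)
    (hmarg : ∀ (j : Fin n) (i : I j),
      IsSelfAdjoint (∑ ii : ∀ j', I j', if ii j = i then A ii else 0) ∧
      (∑ ii : ∀ j', I j', if ii j = i then A ii else 0) *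
          (∑ ii : ∀ j', I j', if ii j = i then A ii else 0)
        = ∑ ii : ∀ j', I j', if ii j = i then A ii else 0) :
    ∀ ii : ∀ j, I j,
      (A ii = ((List.finRange n).map
          fun j => ∑ ii' : ∀ j', I j', if ii' j = ii j then A ii' else 0).prod) ∧
      IsSelfAdjoint (A ii) ∧ A ii * A ii = A ii := by
  classical
  have hpos' : ∀ k, 0 ≤ A k := fun k =>
    (ContinuousLinearMap.nonneg_iff_isPositive (A k)).2 (hpos k)
  intro ii
  have hprod : ∀ k, ((List.finRange n).map
      fun j => ∑ ii' : ∀ j', I j', if ii' j = ii j then A ii' else 0).prod * A k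
        = if k = ii then A k else 0 := by
    intro k
    rw [List.prod_map_mul_eq_ite _ _ (fun j => k j = ii j) _ fun j _ =>
      coarse_graining_mul_of_isStarProjection hpos' hsum (fun l => l j = ii j)
        ⟨(hmarg j (ii j)).2, (hmarg j (ii j)).1⟩ k]
    simp [funext_iff]
  have heq : A ii = ((List.finRange n).map
      fun j => ∑ ii' : ∀ j', I j', if ii' j = ii j then A ii' else 0).prod := by
    rw [← mul_one (List.prod _), ← hsum, Finset.mul_sum, Finset.sum_congr rfl fun k _ => hprod k]
    simp
  refine ⟨heq, (hpos ii).isSelfAdjoint, ?_⟩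
  nth_rewrite 1 [heq]
  rw [hprod, if_pos rfl]
end

section
/- Let G = (I, J, {A_i}, {B_j}, μ, V) be a non-degenerate projection game with projection functions p_{i,j}, in which every question is asked with positive probability (μ(i) := Σ_j μ(i,j) > 0 for all i ∈ I and Σ_i μ(i,j) > 0 for all j ∈ J). Let c(a,b|i,j) = ⟨φ, (P^i_a ⊗ Q^j_b) φ⟩ be a quantum correlation for G where {P^i_a}_{a∈A_i} and {Q^j_b}_{b∈B_j} are POVMs of d × d positive semidefinite matrices, φ = Σ_{n=1}^d λ_n e_n ⊗ e_n with all λ_n > 0 and Σ_n λ_n² = 1, and the tensor product is the Kronecker product. Suppose w_G(c) = 1, and set D = diag(λ_1, …, λ_d). Then: (1) every P^i_a and every Q^j_b is an orthogonal projection; (2) D commutes with every P^i_a and every Q^j_b; (3) P^i_a (Q^j_b)^T = 0 whenever μ(i,j) > 0 and p_{i,j}(a) ≠ b, where ^T denotes the transpose. -/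
open scoped ComplexOrder Kronecker Matrix

namespace PerfectStrategy

theorem sum_sum_kronecker {α β : Type*} [Fintype α] [Fintype β] {n : Type*} (E : α → Matrix n n ℂ)
    (F : β → Matrix n n ℂ) : ∑ a, ∑ b, (E a ⊗ₖ F b) = (∑ a, E a) ⊗ₖ ∑ b, F b := by
  ext k l
  simp [Matrix.sum_apply, Matrix.kroneckerMap_apply, Finset.sum_mul_sum]

variable {n : Type*} [Fintype n]

/-- If the vectorization of `D` has zero expectation under `P ⊗ₖ Q`, then `P * Dᵀ * Qᵀ` vanishes. -/
theorem mul_mul_transpose_eq_zero {P Q D : Matrix n n ℂ} (hP : P.PosSemidef)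
    (hQ : Q.PosSemidef) (h : star D.vec ⬝ᵥ ((P ⊗ₖ Q) *ᵥ D.vec) = 0) : P * Dᵀ * Qᵀ = 0 := by
  have h1 := ((hP.kronecker hQ).dotProduct_mulVec_zero_iff _).1 h
  rw [Matrix.kronecker_mulVec_vec, Matrix.vec_eq_zero_iff] at h1
  simpa [mul_assoc] using congrArg Matrix.transpose h1

variable [DecidableEq n]

/-- A family of matrices summing to one whose distinct members annihilate each other consists of
idempotents. -/
theorem mul_self_of_sum_eq_one {α : Type*} [Fintype α] {E : α → Matrix n n ℂ}
    (hE : ∑ a, E a = 1) (h : ∀ a a', a ≠ a' → E a * E a' = 0) (a : α) : E a * E a = E a := by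
  have h1 : E a * ∑ a', E a' = E a * E a := by
    rw [Finset.mul_sum]
    exact Finset.sum_eq_single a (fun a' _ ha' => h a a' ha'.symm) (by simp)
  rw [← h1, hE, mul_one]

/-- If `E a * X * F b = 0` for all `b ≠ f a`, where `E` and `F` sum to one, then the coarse-graining
of `E` along `f` is intertwined with `F` by `X`. -/
theorem sum_fiber_mul_eq {α β : Type*} [Fintype α] [Fintype β] [DecidableEq β]
    {E : α → Matrix n n ℂ} {F : β → Matrix n n ℂ} {X : Matrix n n ℂ} {f : α → β}
    (hE : ∑ a, E a = 1) (hF : ∑ b, F b = 1) (h : ∀ a b, f a ≠ b → E a * X * F b = 0) (b : β) :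
    (∑ a with f a = b, E a) * X = X * F b := by
  have h1 : ∀ a, E a * X * F (f a) = E a * X := fun a => by
    have h2 : E a * X * ∑ b, F b = E a * X * F (f a) := by
      rw [Finset.mul_sum]
      exact Finset.sum_eq_single (f a) (fun b _ hb => h a b hb.symm) (by simp)
    rw [← h2, hF, mul_one]
  calc (∑ a with f a = b, E a) * X = ∑ a, E a * X * F b := by
        rw [Finset.sum_mul, Finset.sum_filter]
        refine Finset.sum_congr rfl fun a _ => ?_
        split_ifs with hab
        · rw [← hab, h1]
        · rw [h a b hab]
    _ = X * F b := by rw [← Finset.sum_mul, ← Finset.sum_mul, hE, one_mul]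

/-- A matrix commuting with the square of a positive diagonal matrix commutes with the diagonal
matrix itself. -/
theorem commute_diagonal_of_commute_sq {lam : n → ℝ} (hlam : ∀ m, 0 < lam m)
    {M : Matrix n n ℂ}
    (h : Commute (Matrix.diagonal (fun m => (lam m : ℂ)) * Matrix.diagonal fun m => (lam m : ℂ)) M) :
    Commute (Matrix.diagonal fun m => (lam m : ℂ)) M := by
  ext k l
  have h1 := congrFun (congrFun h.eq k) l
  simp only [Matrix.diagonal_mul_diagonal, Matrix.diagonal_mul, Matrix.mul_diagonal] at h1 ⊢
  have h2 : (lam k + lam l : ℂ) ≠ 0 := by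
    exact_mod_cast (add_pos (hlam k) (hlam l)).ne'
  exact mul_left_cancel₀ h2 (by linear_combination h1)

/-- If `D` intertwines two Hermitian matrices, with `D` diagonal and positive, then they are equal
and commute with `D`. -/
theorem eq_and_commute_of_intertwine {lam : n → ℝ} (hlam : ∀ m, 0 < lam m)
    {S R : Matrix n n ℂ} (hS : S.IsHermitian) (hR : R.IsHermitian)
    (h : S * Matrix.diagonal (fun m => (lam m : ℂ)) = Matrix.diagonal (fun m => (lam m : ℂ)) * R) :
    S = R ∧ Commute (Matrix.diagonal fun m => (lam m : ℂ)) R := by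
  set D := Matrix.diagonal fun m => (lam m : ℂ) with hD
  have hDH : Dᴴ = D := by
    simp [hD, Matrix.diagonal_conjTranspose, Pi.star_def]
  have h' : D * S = R * D := by
    have := congrArg Matrix.conjTranspose h
    simpa [Matrix.conjTranspose_mul, hDH, hS.eq, hR.eq] using this
  have hcS : Commute D S := by
    apply commute_diagonal_of_commute_sq hlam
    change D * D * S = S * (D * D)
    rw [mul_assoc, h', ← mul_assoc, ← h, mul_assoc]
  have hSR : S = R := by
    have h1 : D * S = D * R := hcS.eq.trans h
    ext k l
    have h2 := congrFun (congrFun h1 k) l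
    simp only [hD, Matrix.diagonal_mul] at h2
    exact mul_left_cancel₀ (by exact_mod_cast (hlam k).ne') h2
  exact ⟨hSR, hSR ▸ hcS⟩

/-- If a convex combination of numbers at most one equals one, then every number of positive weight
equals one. -/
theorem eq_one_of_weighted_sum_eq_one {ι : Type*} [Fintype ι] {w x : ι → ℝ}
    (hw : ∀ i, 0 ≤ w i) (hw1 : ∑ i, w i = 1) (hx : ∀ i, x i ≤ 1) (h : ∑ i, w i * x i = 1)
    {i : ι} (hi : 0 < w i) : x i = 1 := by
  have h1 : ∑ i, w i * (1 - x i) = 0 := by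
    simp only [mul_sub, mul_one, Finset.sum_sub_distrib, hw1, h, sub_self]
  have h2 := (Finset.sum_eq_zero_iff_of_nonneg
    (fun i _ => mul_nonneg (hw i) (sub_nonneg.2 (hx i)))).1 h1 i (Finset.mem_univ i)
  rcases mul_eq_zero.1 h2 with h3 | h3 <;> linarith

end PerfectStrategy

/-- Structure of perfect quantum strategies for non-degenerate projection
games (in Schmidt form): if `w_G(c) = 1` then all POVM elements `P i a`, `Q j b` are
orthogonal projections, `D = diag(λ)` commutes with all of them, and
`P i a * (Q j b)ᵀ = 0` whenever `μ i j > 0` and `p i j a ≠ b`. -/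
theorem perfect_quantum_strategy_structure
    {I J : Type} [Fintype I] [Fintype J] [Nonempty I] [Nonempty J]
    {A : I → Type} [∀ i, Fintype (A i)] [∀ i, Nonempty (A i)]
    {B : J → Type} [∀ j, Fintype (B j)] [∀ j, Nonempty (B j)]
    (μ : I → J → ℝ) (hμ0 : ∀ i j, 0 ≤ μ i j) (hμ1 : ∑ i, ∑ j, μ i j = 1)
    (p : ∀ i j, A i → B j)
    -- non-degeneracy
    (hnd : ∀ i (a a' : A i), (∀ j, 0 < μ i j → p i j a = p i j a') → a = a')
    -- every question is asked with positive probability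
    (hposI : ∀ i, 0 < ∑ j, μ i j) (hposJ : ∀ j, 0 < ∑ i, μ i j)
    {d : ℕ}
    (P : ∀ i, A i → Matrix (Fin d) (Fin d) ℂ) (Q : ∀ j, B j → Matrix (Fin d) (Fin d) ℂ)
    (hP : ∀ i a, (P i a).PosSemidef) (hPsum : ∀ i, ∑ a, P i a = 1)
    (hQ : ∀ j b, (Q j b).PosSemidef) (hQsum : ∀ j, ∑ b, Q j b = 1)
    (lam : Fin d → ℝ) (hlam : ∀ m, 0 < lam m) (hlam2 : ∑ m, lam m ^ 2 = 1)
    (φ : Fin d × Fin d → ℂ)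
    (hφ : φ = fun nm => if nm.1 = nm.2 then (lam nm.1 : ℂ) else 0)
    (c : ∀ i j, A i → B j → ℝ)
    (hc : ∀ i j a b, (c i j a b : ℂ) = star φ ⬝ᵥ ((P i a ⊗ₖ Q j b) *ᵥ φ))
    -- the strategy is perfect
    (hw : ∑ i, ∑ j, μ i j * ∑ a, c i j a (p i j a) = 1) :
    -- (1) all measurement operators are orthogonal projections
    (∀ i a, (P i a).IsHermitian ∧ P i a * P i a = P i a) ∧
    (∀ j b, (Q j b).IsHermitian ∧ Q j b * Q j b = Q j b) ∧
    -- (2) `D = diag(λ)` commutes with all measurement operators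
    (∀ i a, Matrix.diagonal (fun m => (lam m : ℂ)) * P i a
      = P i a * Matrix.diagonal (fun m => (lam m : ℂ))) ∧
    (∀ j b, Matrix.diagonal (fun m => (lam m : ℂ)) * Q j b
      = Q j b * Matrix.diagonal (fun m => (lam m : ℂ))) ∧
    -- (3) orthogonality relations
    (∀ i j a b, 0 < μ i j → p i j a ≠ b → P i a * (Q j b)ᵀ = 0) := by
  classical
  set D : Matrix (Fin d) (Fin d) ℂ := Matrix.diagonal (fun m => (lam m : ℂ)) with hD
  have hDH : Dᴴ = D := by
    simp [hD, Matrix.diagonal_conjTranspose, Pi.star_def]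
  have hφD : φ = D.vec := by
    subst hφ
    ext ⟨k, l⟩
    by_cases hkl : k = l
    · simp [Matrix.vec, hD, hkl]
    · simp [Matrix.vec, hD, hkl, Ne.symm hkl]
  have hφφ : star φ ⬝ᵥ φ = 1 := by
    have h1 : ∑ m, (lam m : ℂ) * lam m = 1 := by
      simp only [← sq]
      exact_mod_cast hlam2
    subst hφ
    simpa [dotProduct, Fintype.sum_prod_type, apply_ite] using h1
  have hc0 : ∀ i j a b, 0 ≤ c i j a b := fun i j a b => by
    have h1 := ((hP i a).kronecker (hQ j b)).dotProduct_mulVec_nonneg φ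
    rw [← hc] at h1
    exact_mod_cast h1
  have hcsum : ∀ i j, ∑ a, ∑ b, c i j a b = 1 := fun i j => by
    have h1 : ∑ a, ∑ b, (c i j a b : ℂ) = 1 := by
      have h2 : ∑ a, ∑ b, (P i a ⊗ₖ Q j b) = 1 := by
        rw [PerfectStrategy.sum_sum_kronecker, hPsum, hQsum, Matrix.one_kronecker_one]
      simp only [hc, ← dotProduct_sum, ← Matrix.sum_mulVec, h2, Matrix.one_mulVec, hφφ]
    exact_mod_cast h1
  have hcp : ∀ i j a, c i j a (p i j a) ≤ ∑ b, c i j a b := fun i j a =>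
    Finset.single_le_sum (fun b _ => hc0 i j a b) (Finset.mem_univ _)
  have hwin : ∀ i j, 0 < μ i j → ∑ a, c i j a (p i j a) = 1 := fun i j hij => by
    refine PerfectStrategy.eq_one_of_weighted_sum_eq_one (w := fun x : I × J => μ x.1 x.2)
      (x := fun x => ∑ a, c x.1 x.2 a (p x.1 x.2 a)) (fun x => hμ0 _ _) ?_ (fun x => ?_) ?_
      (i := (i, j)) hij
    · rw [Fintype.sum_prod_type, hμ1]
    · exact (Finset.sum_le_sum fun a _ => hcp _ _ a).trans_eq (hcsum _ _)
    · rw [Fintype.sum_prod_type, hw]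
  have hczero : ∀ i j a b, 0 < μ i j → p i j a ≠ b → c i j a b = 0 := fun i j a b hij hab => by
    have h1 := (Finset.sum_eq_sum_iff_of_le fun a _ => hcp i j a).1
      ((hwin i j hij).trans (hcsum i j).symm) a (Finset.mem_univ a)
    have h2 := Finset.add_le_sum (fun b _ => hc0 i j a b) (Finset.mem_univ (p i j a))
      (Finset.mem_univ b) hab
    exact le_antisymm (by linarith) (hc0 i j a b)
  have hPDQ : ∀ i j a b, 0 < μ i j → p i j a ≠ b → P i a * D * (Q j b)ᵀ = 0 :=
    fun i j a b hij hab => by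
      have h1 : star D.vec ⬝ᵥ ((P i a ⊗ₖ Q j b) *ᵥ D.vec) = 0 := by
        rw [← hφD, ← hc, hczero i j a b hij hab, Complex.ofReal_zero]
      have h2 := PerfectStrategy.mul_mul_transpose_eq_zero (hP i a) (hQ j b) h1
      rwa [hD, Matrix.diagonal_transpose] at h2
  have hQTsum : ∀ j, ∑ b, (Q j b)ᵀ = 1 := fun j => by
    rw [← Matrix.transpose_sum, hQsum, Matrix.transpose_one]
  have hcoarse : ∀ i j b, 0 < μ i j →
      ∑ a with p i j a = b, P i a = (Q j b)ᵀ ∧ Commute D (Q j b)ᵀ := fun i j b hij =>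
    PerfectStrategy.eq_and_commute_of_intertwine hlam
      (by
        rw [Matrix.IsHermitian, Matrix.conjTranspose_sum]
        exact Finset.sum_congr rfl fun a _ => (hP i a).isHermitian)
      (hQ j b).isHermitian.transpose
      (PerfectStrategy.sum_fiber_mul_eq (hPsum i) (hQTsum j)
        (fun a b hab => hPDQ i j a b hij hab) b)
  have hexI : ∀ j, ∃ i, 0 < μ i j := fun j => by
    obtain ⟨i, -, hi⟩ := Finset.exists_lt_of_sum_lt
      (f := fun _ => (0 : ℝ)) (g := fun i => μ i j) (by simpa using hposJ j)
    exact ⟨i, hi⟩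
  have hDunit : IsUnit D := by
    rw [hD, Matrix.isUnit_diagonal, Pi.isUnit_iff]
    exact fun m => IsUnit.mk0 _ (by exact_mod_cast (hlam m).ne')
  have horth : ∀ i j a b, 0 < μ i j → p i j a ≠ b → P i a * (Q j b)ᵀ = 0 :=
    fun i j a b hij hab => by
      have h1 := hPDQ i j a b hij hab
      rw [mul_assoc, (hcoarse i j b hij).2.eq, ← mul_assoc] at h1
      exact hDunit.mul_left_eq_zero.1 h1
  have hQT : ∀ j b, (Q j b)ᵀ * (Q j b)ᵀ = (Q j b)ᵀ := fun j => by
    obtain ⟨i, hij⟩ := hexI j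
    refine PerfectStrategy.mul_self_of_sum_eq_one (hQTsum j) fun b b' hbb' => ?_
    rw [← (hcoarse i j b hij).1, Finset.sum_mul]
    refine Finset.sum_eq_zero fun a ha => horth i j a b' hij ?_
    rwa [(Finset.mem_filter.1 ha).2]
  have hPabs : ∀ i j a, 0 < μ i j → (Q j (p i j a))ᵀ * P i a = P i a := fun i j a hij => by
    have h1 : P i a * ∑ b, (Q j b)ᵀ = P i a * (Q j (p i j a))ᵀ := by
      rw [Finset.mul_sum]
      exact Finset.sum_eq_single _ (fun b _ hb => horth i j a b hij hb.symm) (by simp)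
    rw [hQTsum, mul_one] at h1
    have h2 := congrArg Matrix.conjTranspose h1
    rw [Matrix.conjTranspose_mul, (hP i a).isHermitian.eq,
      (hQ j _).isHermitian.transpose.eq] at h2
    exact h2.symm
  have hsep : ∀ i a a', a ≠ a' → ∃ j, 0 < μ i j ∧ p i j a ≠ p i j a' := fun i a a' haa' => by
    by_contra! h
    exact haa' (hnd i a a' h)
  have hPP : ∀ i a, P i a * P i a = P i a := fun i =>
    PerfectStrategy.mul_self_of_sum_eq_one (hPsum i) fun a a' haa' => by
      obtain ⟨j, hij, hne⟩ := hsep i a a' haa'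
      rw [← hPabs i j a' hij, ← mul_assoc, horth i j a _ hij hne, zero_mul]
  have hPDP : ∀ i a, D * P i a = P i a * D * P i a := fun i a => by
    have h1 : (∑ a', P i a') * (D * P i a) = P i a * (D * P i a) := by
      rw [Finset.sum_mul]
      refine Finset.sum_eq_single a (fun a' _ haa' => ?_) (by simp)
      obtain ⟨j, hij, hne⟩ := hsep i a' a haa'
      rw [← hPabs i j a hij, ← mul_assoc, ← mul_assoc, hPDQ i j a' _ hij hne, zero_mul]
    rwa [hPsum, one_mul, ← mul_assoc] at h1
  refine ⟨fun i a => ⟨(hP i a).isHermitian, hPP i a⟩, fun j b => ⟨(hQ j b).isHermitian, ?_⟩,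
    fun i a => ?_, fun j b => ?_, horth⟩
  · simpa using congrArg Matrix.transpose (hQT j b)
  · have h1 := congrArg Matrix.conjTranspose (hPDP i a)
    simp only [Matrix.conjTranspose_mul, hDH, (hP i a).isHermitian.eq] at h1
    rw [h1, ← mul_assoc, ← hPDP]
  · obtain ⟨i, hij⟩ := hexI j
    have h1 := congrArg Matrix.transpose (hcoarse i j b hij).2.eq
    simpa [hD] using h1.symm
end

section
/- Let G be a non-degenerate projection game in which every question is asked with positive probability (Σ_j μ(i,j) > 0 for all i ∈ I and Σ_i μ(i,j) > 0 for all j ∈ J), and let c be a quantum correlation for G with w_G(c) = 1. Then c is a finite-dimensional tracial correlation: there exist n ≥ 1, PVMs {A^i_a}_{a∈A_i} and {B^j_b}_{b∈B_j} of orthogonal projections in the n × n complex matrices, and a positive semidefinite matrix σ with Tr(σ) = 1 satisfying Tr(σ x y) = Tr(σ y x) for all x, y in the unital *-subalgebra of M_n(ℂ) generated by all the A^i_a and B^j_b, such that c(a,b|i,j) = Tr(σ A^i_a B^j_b) for all i, j, a, b. -/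
open scoped ComplexOrder Kronecker Matrix

namespace Matrix

variable {n m α : Type*} [Fintype n] [Fintype m] [Fintype α]

/-- Every Hermitian matrix has a support projection, which commutes with everything
that commutes with the matrix. -/
lemma IsHermitian.exists_support_projection [DecidableEq n] {ρ : Matrix n n ℂ}
    (hρ : ρ.IsHermitian) :
    ∃ S T : Matrix n n ℂ, S.IsHermitian ∧ S * S = S ∧ S = ρ * T ∧ S * ρ = ρ ∧
      ∀ X, Commute ρ X → Commute S X := by
  have hsa : IsSelfAdjoint ρ := hρ
  have hcont (f : ℝ → ℝ) : ContinuousOn f (spectrum ℝ ρ) :=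
    (Matrix.finite_real_spectrum (A := ρ)).continuousOn f
  refine ⟨cfc (fun x : ℝ => x * x⁻¹) ρ, cfc (fun x : ℝ => x⁻¹) ρ, ?_, ?_, ?_, ?_, ?_⟩
  · exact cfc_predicate (p := IsSelfAdjoint) _ ρ
  · rw [← cfc_mul _ _ ρ (hcont _) (hcont _)]
    refine cfc_congr fun x _ => ?_
    by_cases h : x = 0 <;> simp [h]
  · rw [cfc_mul _ _ ρ (hcont _) (hcont _), cfc_id' ℝ ρ]
  · calc cfc (fun x : ℝ => x * x⁻¹) ρ * ρ
        = cfc (fun x : ℝ => x * x⁻¹) ρ * cfc (fun x : ℝ => x) ρ := by rw [cfc_id' ℝ ρ]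
      _ = cfc (fun x : ℝ => x) ρ := by
        rw [← cfc_mul _ _ ρ (hcont _) (hcont _)]
        refine cfc_congr fun x _ => ?_
        by_cases h : x = 0 <;> simp [h]
      _ = ρ := cfc_id' ℝ ρ
  · intro X hX
    exact hsa.commute_cfc hX _

/-- If the off-diagonal blocks of `ρ` with respect to a Hermitian resolution of the identity vanish,
then each member of the resolution commutes with `ρ`. -/
lemma commute_of_offDiag_eq_zero [DecidableEq n] {P : α → Matrix n n ℂ}
    (hsum : ∑ a, P a = 1) {ρ : Matrix n n ℂ}
    (hoff : ∀ a a', a ≠ a' → P a * ρ * P a' = 0) (a : α) : Commute (P a) ρ := by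
  have hl : P a * ρ = P a * ρ * P a := by
    rw [← Fintype.sum_eq_single (f := fun b => P a * ρ * P b) a (fun b hb => hoff a b hb.symm),
      ← Finset.mul_sum, hsum, mul_one]
  have hr : ρ * P a = P a * ρ * P a := by
    rw [← Fintype.sum_eq_single (f := fun b => P b * ρ * P a) a
      (fun b hb => hoff b a hb), ← Finset.sum_mul, ← Finset.sum_mul, hsum, one_mul]
  exact hl.trans hr.symm

/-- A Hermitian resolution of the identity for which the off-diagonal blocks of `ρ` vanish agrees
on the range of `ρ` with a projective one commuting with `ρ`. -/
lemma exists_projective_resolution [DecidableEq n] [Nonempty α] {P : α → Matrix n n ℂ}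
    (hP : ∀ a, (P a).IsHermitian) (hsum : ∑ a, P a = 1) {ρ : Matrix n n ℂ} (hρ : ρ.IsHermitian)
    (hoff : ∀ a a', a ≠ a' → P a * ρ * P a' = 0) :
    ∃ r : α → Matrix n n ℂ, (∀ a, (r a).IsHermitian) ∧ (∀ a, r a * r a = r a) ∧
      (∀ a a', a ≠ a' → r a * r a' = 0) ∧ ∑ a, r a = 1 ∧ (∀ a, r a * ρ = P a * ρ) ∧
      ∀ a, Commute (r a) ρ := by
  classical
  obtain ⟨S, T, hSh, hSS, hST, hSρ, hScomm⟩ := hρ.exists_support_projection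
  have hPρ := commute_of_offDiag_eq_zero hsum hoff
  have hPS (a : α) : S * P a = P a * S := hScomm _ (hPρ a).symm
  have horth (a a' : α) (h : a ≠ a') : P a * P a' * S = 0 := by
    rw [hST, mul_assoc, ← mul_assoc (P a'), (hPρ a').eq, mul_assoc ρ, ← mul_assoc, ← mul_assoc,
      hoff a a' h, zero_mul]
  have hidem (a : α) : P a * P a * S = P a * S := by
    rw [← Fintype.sum_eq_single (f := fun b => P a * P b * S) a
      (fun b hb => horth a b hb.symm), ← Finset.sum_mul, ← Finset.mul_sum, hsum,
      mul_one]
  have hPSPS (a a' : α) : P a * S * (P a' * S) = P a * P a' * S := by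
    rw [mul_assoc, ← mul_assoc S, hPS, mul_assoc (P a'), hSS, mul_assoc]
  let a₀ : α := Classical.arbitrary α
  let R (a : α) : Matrix n n ℂ := if a = a₀ then 1 - S else 0
  have hRS (a : α) : R a * S = 0 := by
    simp only [R]; split_ifs <;> simp [sub_mul, hSS]
  have hSR (a : α) : S * R a = 0 := by
    simp only [R]; split_ifs <;> simp [mul_sub, hSS]
  have hRR (a : α) : R a * R a = R a := by
    simp only [R]; split_ifs <;> simp [mul_sub, sub_mul, hSS]
  have hRR' (a a' : α) (h : a ≠ a') : R a * R a' = 0 := by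
    simp only [R]; split_ifs <;> simp_all
  have hRh (a : α) : (R a).IsHermitian := by
    simp only [R]; split_ifs
    · exact isHermitian_one.sub hSh
    · exact isHermitian_zero
  have hmul (a a' : α) : (P a * S + R a) * (P a' * S + R a') = P a * P a' * S + R a * R a' := by
    have h1 : R a * (P a' * S) = 0 := by rw [← hPS, ← mul_assoc, hRS, zero_mul]
    have h2 : P a * S * R a' = 0 := by rw [mul_assoc, hSR, mul_zero]
    rw [add_mul, mul_add, mul_add, hPSPS, h1, h2, add_zero, zero_add]
  have hrρ (a : α) : (P a * S + R a) * ρ = P a * ρ := by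
    have h1 : R a * ρ = 0 := by rw [← hSρ, ← mul_assoc, hRS, zero_mul]
    rw [add_mul, h1, add_zero, mul_assoc, hSρ]
  have hrh (a : α) : (P a * S + R a).IsHermitian := by
    refine IsHermitian.add ?_ (hRh a)
    rw [IsHermitian, conjTranspose_mul, (hP a).eq, hSh.eq, hPS]
  refine ⟨fun a => P a * S + R a, hrh, fun a => ?_, fun a a' h => ?_, ?_, hrρ, fun a => ?_⟩
  · rw [hmul, hidem, hRR]
  · rw [hmul, horth a a' h, hRR' a a' h, add_zero]
  · rw [Finset.sum_add_distrib, ← Finset.sum_mul, hsum]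
    simp [R]
  · have h := congrArg conjTranspose (hrρ a)
    rw [conjTranspose_mul, conjTranspose_mul, hρ.eq, (hP a).eq, (hrh a).eq] at h
    exact (hrρ a).trans ((hPρ a).eq.trans h.symm)

/-- Coarse-graining a projective resolution of the identity yields projections. -/
lemma sum_filter_mul_self {β : Type*} [DecidableEq β] {r : α → Matrix n n ℂ}
    (hidem : ∀ a, r a * r a = r a) (horth : ∀ a a', a ≠ a' → r a * r a' = 0)
    (f : α → β) (b : β) :
    (∑ a with f a = b, r a) * (∑ a with f a = b, r a) = ∑ a with f a = b, r a := by
  rw [Finset.sum_mul_sum]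
  refine Finset.sum_congr rfl fun a ha => ?_
  rw [Finset.sum_eq_single_of_mem a ha fun a' _ h => horth a a' h.symm, hidem]

/-- The coefficient matrix of a bipartite vector. -/
def ofVec (ψ : n × m → ℂ) : Matrix n m ℂ := of fun x y => ψ (x, y)

lemma kronecker_mulVec_apply (X : Matrix n n ℂ) (Y : Matrix m m ℂ) (ψ : n × m → ℂ) (x : n) (y : m) :
    ((X ⊗ₖ Y) *ᵥ ψ) (x, y) = (X * ofVec ψ * Yᵀ) x y := by
  simp only [mulVec, dotProduct, mul_apply, kroneckerMap_apply, Fintype.sum_prod_type,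
    transpose_apply, ofVec, of_apply, Finset.sum_mul]
  rw [Finset.sum_comm]
  exact Finset.sum_congr rfl fun _ _ => Finset.sum_congr rfl fun _ _ => by ring

lemma star_dotProduct_eq_trace (ψ φ : n × m → ℂ) :
    star ψ ⬝ᵥ φ = ((ofVec ψ)ᴴ * ofVec φ).trace := by
  simp only [dotProduct, trace, diag_apply, mul_apply, conjTranspose_apply, ofVec, of_apply,
    Fintype.sum_prod_type, Pi.star_apply]
  exact Finset.sum_comm

lemma star_dotProduct_kronecker_mulVec (X : Matrix n n ℂ) (Y : Matrix m m ℂ) (ψ : n × m → ℂ) :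
    star ψ ⬝ᵥ ((X ⊗ₖ Y) *ᵥ ψ) = ((ofVec ψ)ᴴ * (X * ofVec ψ * Yᵀ)).trace := by
  rw [star_dotProduct_eq_trace]
  congr 2
  ext x y
  exact kronecker_mulVec_apply X Y ψ x y

/-- Vanishing of the probability of an outcome pair annihilates the coefficient matrix. -/
lemma PosSemidef.mul_ofVec_mul_transpose_eq_zero [DecidableEq n] [DecidableEq m]
    {X : Matrix n n ℂ} {Y : Matrix m m ℂ}
    (hX : X.PosSemidef) (hY : Y.PosSemidef) {ψ : n × m → ℂ}
    (h : star ψ ⬝ᵥ ((X ⊗ₖ Y) *ᵥ ψ) = 0) : X * ofVec ψ * Yᵀ = 0 := by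
  have h0 := ((hX.kronecker hY).dotProduct_mulVec_zero_iff ψ).1 h
  ext x y
  rw [← kronecker_mulVec_apply, h0]
  rfl

/-- A matrix commuting with a set of Hermitian generators is tracial on the
star algebra they generate. -/
lemma trace_mul_comm_of_mem_adjoin [DecidableEq n] {σ : Matrix n n ℂ} {s : Set (Matrix n n ℂ)}
    (hs : ∀ M ∈ s, M.IsHermitian) (hσ : ∀ M ∈ s, Commute σ M) {x : Matrix n n ℂ}
    (hx : x ∈ StarAlgebra.adjoin ℂ s) (y : Matrix n n ℂ) :
    (σ * (x * y)).trace = (σ * (y * x)).trace := by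
  have hle : StarAlgebra.adjoin ℂ s ≤ StarSubalgebra.centralizer ℂ {σ} := by
    rw [StarAlgebra.adjoin_le_iff]
    intro M hM
    rw [SetLike.mem_coe, StarSubalgebra.mem_centralizer_iff]
    rintro _ rfl
    refine ⟨hσ M hM, ?_⟩
    have h := congrArg star (hσ M hM).eq
    rw [star_mul, star_mul, star_eq_conjTranspose M, (hs M hM).eq] at h
    exact h.symm
  have hxσ : σ * x = x * σ := (StarSubalgebra.mem_centralizer_iff ℂ).1 (hle hx) σ rfl |>.1
  rw [← mul_assoc, hxσ, mul_assoc, trace_mul_comm, mul_assoc]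

end Matrix

/-- In a perfect strategy the losing outcomes of every question pair of positive probability
have probability zero. -/
lemma losing_eq_zero_of_perfect {I J : Type*} [Fintype I] [Fintype J]
    {A : I → Type*} [∀ i, Fintype (A i)] {B : J → Type*} [∀ j, Fintype (B j)]
    {μ : I → J → ℝ} (hμ0 : ∀ i j, 0 ≤ μ i j) (hμ1 : ∑ i, ∑ j, μ i j = 1)
    {p : ∀ i j, A i → B j} {c : ∀ i j, A i → B j → ℝ}
    (hc0 : ∀ i j a b, 0 ≤ c i j a b) (hc1 : ∀ i j, ∑ a, ∑ b, c i j a b = 1)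
    (hw : ∑ i, ∑ j, μ i j * ∑ a, c i j a (p i j a) = 1)
    {i : I} {j : J} (hij : 0 < μ i j) {a : A i} {b : B j} (hb : b ≠ p i j a) :
    c i j a b = 0 := by
  classical
  have hle (i j) (a : A i) : c i j a (p i j a) ≤ ∑ b, c i j a b :=
    Finset.single_le_sum (fun b _ => hc0 i j a b) (Finset.mem_univ _)
  have hwin (i j) : ∑ a, c i j a (p i j a) ≤ 1 :=
    (Finset.sum_le_sum fun a _ => hle i j a).trans_eq (hc1 i j)
  have hterm (i j) : μ i j * ∑ a, c i j a (p i j a) ≤ μ i j :=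
    mul_le_of_le_one_right (hμ0 i j) (hwin i j)
  have h1 := (Finset.sum_eq_sum_iff_of_le fun i _ => Finset.sum_le_sum fun j _ => hterm i j).1
    (hw.trans hμ1.symm) i (Finset.mem_univ i)
  have h2 := (Finset.sum_eq_sum_iff_of_le fun j _ => hterm i j).1 h1 j (Finset.mem_univ j)
  have h3 : ∑ a, c i j a (p i j a) = 1 := mul_left_cancel₀ hij.ne' (h2.trans (mul_one _).symm)
  have h4 := (Finset.sum_eq_sum_iff_of_le fun a _ => hle i j a).1
    (h3.trans (hc1 i j).symm) a (Finset.mem_univ a)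
  rw [← Finset.add_sum_erase _ _ (Finset.mem_univ (p i j a)), left_eq_add,
    Finset.sum_eq_zero_iff_of_nonneg fun b _ => hc0 i j a b] at h4
  exact h4 b (Finset.mem_erase.2 ⟨hb, Finset.mem_univ b⟩)

/-- A perfect quantum strategy for a non-degenerate projection game
(in which every question is asked with positive probability) gives a finite-dimensional
tracial correlation: `c(a,b|i,j) = Tr(σ A^i_a B^j_b)` for PVMs of projections in `Mₙ(ℂ)`
and a density matrix `σ` tracial on the generated unital *-subalgebra. -/
theorem perfect_quantum_strategy_is_tracial
    {I J : Type} [Fintype I] [Fintype J] [Nonempty I] [Nonempty J]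
    {A : I → Type} [∀ i, Fintype (A i)] [∀ i, Nonempty (A i)]
    {B : J → Type} [∀ j, Fintype (B j)] [∀ j, Nonempty (B j)]
    (μ : I → J → ℝ) (hμ0 : ∀ i j, 0 ≤ μ i j) (hμ1 : ∑ i, ∑ j, μ i j = 1)
    (p : ∀ i j, A i → B j)
    (hnd : ∀ i (a a' : A i), (∀ j, 0 < μ i j → p i j a = p i j a') → a = a')
    (hposI : ∀ i, 0 < ∑ j, μ i j) (hposJ : ∀ j, 0 < ∑ i, μ i j)
    -- `c` is a quantum correlation
    {dA dB : ℕ}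
    (P : ∀ i, A i → Matrix (Fin dA) (Fin dA) ℂ)
    (Q : ∀ j, B j → Matrix (Fin dB) (Fin dB) ℂ)
    (hP : ∀ i a, (P i a).PosSemidef) (hPsum : ∀ i, ∑ a, P i a = 1)
    (hQ : ∀ j b, (Q j b).PosSemidef) (hQsum : ∀ j, ∑ b, Q j b = 1)
    (ψ : Fin dA × Fin dB → ℂ) (hψ : star ψ ⬝ᵥ ψ = 1)
    (c : ∀ i j, A i → B j → ℝ)
    (hc : ∀ i j a b, (c i j a b : ℂ) = star ψ ⬝ᵥ ((P i a ⊗ₖ Q j b) *ᵥ ψ))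
    -- the strategy is perfect
    (hw : ∑ i, ∑ j, μ i j * ∑ a, c i j a (p i j a) = 1) :
    ∃ (n : ℕ) (r : ∀ i, A i → Matrix (Fin n) (Fin n) ℂ)
      (s : ∀ j, B j → Matrix (Fin n) (Fin n) ℂ) (σ : Matrix (Fin n) (Fin n) ℂ),
      1 ≤ n ∧
      (∀ i a, (r i a).IsHermitian ∧ r i a * r i a = r i a) ∧ (∀ i, ∑ a, r i a = 1) ∧
      (∀ j b, (s j b).IsHermitian ∧ s j b * s j b = s j b) ∧ (∀ j, ∑ b, s j b = 1) ∧
      σ.PosSemidef ∧ σ.trace = 1 ∧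
      (∀ x y : Matrix (Fin n) (Fin n) ℂ,
        x ∈ StarAlgebra.adjoin ℂ
          ({M | ∃ i a, M = r i a} ∪ {M | ∃ j b, M = s j b}) →
        y ∈ StarAlgebra.adjoin ℂ
          ({M | ∃ i a, M = r i a} ∪ {M | ∃ j b, M = s j b}) →
        (σ * (x * y)).trace = (σ * (y * x)).trace) ∧
      (∀ i j a b, (c i j a b : ℂ) = (σ * (r i a * s j b)).trace) := by
  classical
  set K : Matrix (Fin dA) (Fin dB) ℂ := Matrix.ofVec ψ with hK
  set ρ : Matrix (Fin dA) (Fin dA) ℂ := K * Kᴴ with hρdef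
  have hρ : ρ.PosSemidef := Matrix.posSemidef_self_mul_conjTranspose K
  have hρtr : ρ.trace = 1 := by
    rw [hρdef, Matrix.trace_mul_comm, ← hψ, Matrix.star_dotProduct_eq_trace]
  have hctr (i j a b) : (c i j a b : ℂ) = (Kᴴ * (P i a * K * (Q j b)ᵀ)).trace := by
    rw [hc, Matrix.star_dotProduct_kronecker_mulVec]
  have hQT (j) : ∑ b, (Q j b)ᵀ = 1 := by
    rw [← Matrix.transpose_sum, hQsum, Matrix.transpose_one]
  have hc0 (i j a b) : 0 ≤ c i j a b := by
    have h := ((hP i a).kronecker (hQ j b)).dotProduct_mulVec_nonneg ψ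
    rw [← hc] at h
    exact_mod_cast h
  have hc1 (i j) : ∑ a, ∑ b, c i j a b = 1 := by
    have h : ((∑ a, ∑ b, c i j a b : ℝ) : ℂ) = 1 := by
      push_cast
      simp_rw [hctr, ← Matrix.trace_sum, ← Matrix.mul_sum, hQT, Matrix.mul_one,
        ← Matrix.sum_mul, hPsum, Matrix.one_mul]
      rw [Matrix.trace_mul_comm, hρtr]
    exact_mod_cast h
  have hzero {i j} (hij : 0 < μ i j) {a : A i} {b : B j} (hb : b ≠ p i j a) :
      P i a * K * (Q j b)ᵀ = 0 := by
    refine (hP i a).mul_ofVec_mul_transpose_eq_zero (hQ j b) ?_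
    rw [← hc, losing_eq_zero_of_perfect hμ0 hμ1 hc0 hc1 hw hij hb, Complex.ofReal_zero]
  have hself {i j} (hij : 0 < μ i j) (a : A i) :
      P i a * K * (Q j (p i j a))ᵀ = P i a * K := by
    rw [← Fintype.sum_eq_single (f := fun b => P i a * K * (Q j b)ᵀ) (p i j a)
      (fun b hb => hzero hij hb), ← Matrix.mul_sum, hQT, Matrix.mul_one]
  have hoff (i) (a a' : A i) (haa : a ≠ a') : P i a * ρ * P i a' = 0 := by
    obtain ⟨j, hij, hj⟩ : ∃ j, 0 < μ i j ∧ p i j a ≠ p i j a' := by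
      by_contra! h
      exact haa (hnd i a a' h)
    have h := congrArg Matrix.conjTranspose (hself hij a')
    have hQh : ((Q j (p i j a'))ᵀ)ᴴ = (Q j (p i j a'))ᵀ := (hQ j _).1.transpose
    rw [Matrix.conjTranspose_mul, hQh, Matrix.conjTranspose_mul, (hP i a').1.eq] at h
    rw [hρdef, Matrix.mul_assoc, Matrix.mul_assoc K, ← h, ← Matrix.mul_assoc, ← Matrix.mul_assoc,
      hzero hij hj.symm, Matrix.zero_mul]
  have hcoarse {i j} (hij : 0 < μ i j) (b : B j) :
      K * (Q j b)ᵀ = (∑ a with p i j a = b, P i a) * K := by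
    have h : K * (Q j b)ᵀ = ∑ a, P i a * K * (Q j b)ᵀ := by
      rw [← Matrix.sum_mul, ← Matrix.sum_mul, hPsum, Matrix.one_mul]
    rw [h, Matrix.sum_mul, Finset.sum_filter]
    refine Finset.sum_congr rfl fun a _ => ?_
    split_ifs with hab
    · rw [← hab, hself hij]
    · exact hzero hij (Ne.symm hab)
  choose r hrh hrr hro hrs hrρ hrc using fun i =>
    Matrix.exists_projective_resolution (fun a => (hP i a).1) (hPsum i) hρ.1 (hoff i)
  have hq (j) : ∃ i, 0 < μ i j := by
    by_contra! h
    exact (hposJ j).not_ge (Finset.sum_nonpos fun i _ => h i)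
  choose q hq using hq
  let s (j : J) (b : B j) : Matrix (Fin dA) (Fin dA) ℂ := ∑ a with p (q j) j a = b, r (q j) a
  have hsh (j b) : (s j b).IsHermitian := by
    rw [Matrix.IsHermitian, Matrix.conjTranspose_sum]
    exact Finset.sum_congr rfl fun a _ => hrh _ a
  have hsc (j b) : Commute (s j b) ρ := Commute.sum_left _ _ _ fun a _ => hrc _ a
  refine ⟨dA, r, s, ρ, ?_, fun i a => ⟨hrh i a, hrr i a⟩, hrs,
    fun j b => ⟨hsh j b, Matrix.sum_filter_mul_self (hrr _) (hro _) _ b⟩, fun j => ?_, hρ, hρtr,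
    fun x y hx _ => Matrix.trace_mul_comm_of_mem_adjoin ?_ ?_ hx y, fun i j a b => ?_⟩
  · rw [Nat.one_le_iff_ne_zero]
    rintro rfl
    simp [Matrix.trace] at hρtr
  · exact (Finset.sum_fiberwise Finset.univ (p (q j) j) (r (q j))).trans (hrs _)
  · rintro _ (⟨i, a, rfl⟩ | ⟨j, b, rfl⟩)
    exacts [hrh i a, hsh j b]
  · rintro _ (⟨i, a, rfl⟩ | ⟨j, b, rfl⟩)
    exacts [(hrc i a).symm, (hsc j b).symm]
  · have hsρ : s j b * ρ = (∑ a with p (q j) j a = b, P (q j) a) * ρ := by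
      simp only [s, Matrix.sum_mul, hrρ]
    have hrsρ : ρ * (r i a * s j b) = P i a * (s j b * ρ) := by
      rw [← Matrix.mul_assoc, ← (hrc i a).eq, hrρ, Matrix.mul_assoc, (hsc j b).eq]
    rw [hctr, hrsρ, hsρ, Matrix.mul_assoc, hcoarse (hq j), Matrix.trace_mul_comm, hρdef]
    simp only [Matrix.mul_assoc]
end

section
/- Let G = (I, J, {A_i}, {B_j}, μ, V) be a non-degenerate projection game in which every question is asked with positive probability (Σ_j μ(i,j) > 0 for all i ∈ I and Σ_i μ(i,j) > 0 for all j ∈ J), and let c(a,b|i,j) = ⟨ψ, P^i_a Q^j_b ψ⟩ be a commuting operator correlation for G with w_G(c) = 1. Then c is a tracial correlation: there exist a complex Hilbert space K, a unit vector ξ ∈ K, and PVMs {p^i_a}_{a∈A_i} and {q^j_b}_{b∈B_j} of orthogonal projections on K such that ⟨ξ, x y ξ⟩ = ⟨ξ, y x ξ⟩ for all x, y in the unital *-subalgebra of bounded operators on K generated by all the p^i_a and q^j_b, and c(a,b|i,j) = ⟨ξ, p^i_a q^j_b ξ⟩ for all i, j, a, b. -/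
open scoped InnerProductSpace

section

variable {H : Type*} [NormedAddCommGroup H] [InnerProductSpace ℂ H]

lemma sum_re_inner_mul_eq {α β : Type*} [Fintype α] [Fintype β] {P : α → H →L[ℂ] H}
    {Q : β → H →L[ℂ] H} (hPsum : ∑ a, P a = 1) (hQsum : ∑ b, Q b = 1) (ψ : H) :
    ∑ a, ∑ b, (⟪ψ, (P a * Q b) ψ⟫_ℂ).re = ‖ψ‖ ^ 2 := by
  have h : ∑ a, ∑ b, (P a * Q b) = 1 := by
    simp only [← Finset.mul_sum, hPsum, hQsum, mul_one]
  have h' : ⟪ψ, (∑ a, ∑ b, (P a * Q b)) ψ⟫_ℂ = ∑ a, ∑ b, ⟪ψ, (P a * Q b) ψ⟫_ℂ := by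
    simp only [sum_apply, inner_sum]
  rw [h, one_apply_eq_self, inner_self_eq_norm_sq_to_K] at h'
  have h'' := congrArg Complex.re h'
  simp only [Complex.re_sum] at h''
  rw [← h'']
  norm_cast

variable [CompleteSpace H]

/-- A positive operator annihilates every vector on which its quadratic form vanishes. -/
lemma ContinuousLinearMap.IsPositive.apply_eq_zero {T : H →L[ℂ] H} (hT : T.IsPositive) {x : H}
    (h : (⟪x, T x⟫_ℂ).re = 0) : T x = 0 := by
  obtain ⟨b, rfl⟩ := CStarAlgebra.nonneg_iff_eq_star_mul_self.1
    ((ContinuousLinearMap.nonneg_iff_isPositive T).2 hT)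
  have hb : b x = 0 := by
    rw [mul_apply_eq_comp, ContinuousLinearMap.star_eq_adjoint,
      ContinuousLinearMap.adjoint_inner_right, inner_self_eq_norm_sq_to_K] at h
    simpa [← Complex.ofReal_pow] using h
  simp [hb]

lemma ContinuousLinearMap.IsPositive.mul_of_commute {S T : H →L[ℂ] H} (hS : S.IsPositive)
    (hT : T.IsPositive) (h : Commute S T) : (S * T).IsPositive :=
  (ContinuousLinearMap.nonneg_iff_isPositive _).1 <| Commute.mul_nonneg
    ((ContinuousLinearMap.nonneg_iff_isPositive S).2 hS)
    ((ContinuousLinearMap.nonneg_iff_isPositive T).2 hT) h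

section POVM

variable {α β : Type*} [Fintype α] [Fintype β] {P : α → H →L[ℂ] H} {Q : β → H →L[ℂ] H}

lemma sum_re_inner_mul_le (hP : ∀ a, (P a).IsPositive) (hPsum : ∑ a, P a = 1)
    (hQ : ∀ b, (Q b).IsPositive) (hQsum : ∑ b, Q b = 1) (hcomm : ∀ a b, Commute (P a) (Q b))
    (p : α → β) (ψ : H) : ∑ a, (⟪ψ, (P a * Q (p a)) ψ⟫_ℂ).re ≤ ‖ψ‖ ^ 2 := by
  rw [← sum_re_inner_mul_eq hPsum hQsum ψ]
  refine Finset.sum_le_sum fun a _ => ?_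
  exact Finset.single_le_sum (f := fun b => (⟪ψ, (P a * Q b) ψ⟫_ℂ).re)
    (fun b _ => ((hP a).mul_of_commute (hQ b) (hcomm a b)).re_inner_nonneg_right ψ)
    (Finset.mem_univ _)

/-- If the answers of two commuting POVMs in the state `ψ` are related by `b = p a` with
certainty, then `P a (Q b ψ)` is `P a ψ` or `0` according as `b = p a` or not. -/
lemma povm_apply_apply_of_perfect [DecidableEq β]
    (hP : ∀ a, (P a).IsPositive) (hPsum : ∑ a, P a = 1)
    (hQ : ∀ b, (Q b).IsPositive) (hQsum : ∑ b, Q b = 1) (hcomm : ∀ a b, Commute (P a) (Q b))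
    (p : α → β) (ψ : H) (h : ∑ a, (⟪ψ, (P a * Q (p a)) ψ⟫_ℂ).re = ‖ψ‖ ^ 2) (a : α) (b : β) :
    P a (Q b ψ) = if b = p a then P a ψ else 0 := by
  have hpos (a b) := (hP a).mul_of_commute (hQ b) (hcomm a b)
  have hle : ∀ a ∈ Finset.univ, (⟪ψ, (P a * Q (p a)) ψ⟫_ℂ).re
      ≤ ∑ b, (⟪ψ, (P a * Q b) ψ⟫_ℂ).re := fun a _ =>
    Finset.single_le_sum (f := fun b => (⟪ψ, (P a * Q b) ψ⟫_ℂ).re)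
      (fun b _ => (hpos a b).re_inner_nonneg_right ψ) (Finset.mem_univ _)
  have heq := (Finset.sum_eq_sum_iff_of_le hle).1
    (h.trans (sum_re_inner_mul_eq hPsum hQsum ψ).symm) a (Finset.mem_univ a)
  have hzero : ∀ b, b ≠ p a → P a (Q b ψ) = 0 := by
    intro b hb
    refine (hpos a b).apply_eq_zero ?_
    rw [← Finset.add_sum_erase _ _ (Finset.mem_univ (p a)), left_eq_add] at heq
    exact (Finset.sum_eq_zero_iff_of_nonneg fun b _ =>
      (hpos a b).re_inner_nonneg_right ψ).1 heq b (Finset.mem_erase.2 ⟨hb, Finset.mem_univ b⟩)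
  split_ifs with hb
  · have hsum : P a ψ = ∑ b, P a (Q b ψ) := by
      rw [← map_sum, ← sum_apply, hQsum, one_apply_eq_self]
    rw [hsum, Finset.sum_eq_single_of_mem b (Finset.mem_univ b)]
    exact fun b' _ hb' => hzero b' (hb ▸ hb')
  · exact hzero b hb

end POVM

lemma IsSelfAdjoint.commute_of_mem_adjoin {R : H →L[ℂ] H} (hR : IsSelfAdjoint R)
    {s : Set (H →L[ℂ] H)} (hs : ∀ y ∈ s, Commute R y) {x : H →L[ℂ] H}
    (hx : x ∈ StarAlgebra.adjoin ℂ s) : Commute R x := by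
  induction hx using StarAlgebra.adjoin_induction with
  | mem y hy => exact hs y hy
  | algebraMap r => exact (Algebra.commutes r R).symm
  | add x y _ _ hx hy => exact hx.add_right hy
  | mul x y _ _ hx hy => exact hx.mul_right hy
  | star x _ hx => simpa [hR.star_eq] using hx.star_star

lemma inner_apply_star_apply (x y : H →L[ℂ] H) (ψ : H) :
    ⟪ψ, (star x * y) ψ⟫_ℂ = ⟪x ψ, y ψ⟫_ℂ := by
  rw [mul_apply_eq_comp, ContinuousLinearMap.star_eq_adjoint,
    ContinuousLinearMap.adjoint_inner_right]

/-- A vector state is tracial on the *-algebra generated by self-adjoint operators, each of which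
acts on the vector as a self-adjoint operator commuting with all the generators. -/
lemma inner_mul_comm_of_mem_adjoin {s : Set (H →L[ℂ] H)} {ψ : H}
    (hs : ∀ x ∈ s, IsSelfAdjoint x ∧ ∃ R : H →L[ℂ] H, IsSelfAdjoint R ∧
      (∀ y ∈ s, Commute R y) ∧ x ψ = R ψ)
    {x y : H →L[ℂ] H} (hx : x ∈ StarAlgebra.adjoin ℂ s) (hy : y ∈ StarAlgebra.adjoin ℂ s) :
    ⟪ψ, (x * y) ψ⟫_ℂ = ⟪ψ, (y * x) ψ⟫_ℂ := by
  induction hx using StarAlgebra.adjoin_induction generalizing y with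
  | mem x hx =>
    obtain ⟨hxs, R, hR, hRs, hxR⟩ := hs x hx
    have hRy := hR.commute_of_mem_adjoin hRs hy
    calc ⟪ψ, (x * y) ψ⟫_ℂ = ⟪x ψ, y ψ⟫_ℂ := by
          rw [← inner_apply_star_apply, hxs.star_eq]
      _ = ⟪ψ, (R * y) ψ⟫_ℂ := by rw [hxR, ← inner_apply_star_apply, hR.star_eq]
      _ = ⟪ψ, (y * x) ψ⟫_ℂ := by
          rw [hRy.eq, mul_apply_eq_comp, mul_apply_eq_comp, hxR]
  | algebraMap r => rw [Algebra.commutes r y]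
  | add x x' _ _ h h' =>
    simp only [add_mul, mul_add, add_apply, inner_add_right, h hy, h' hy]
  | mul x x' hx hx' h h' =>
    rw [mul_assoc, h (mul_mem hx' hy), mul_assoc, h' (mul_mem hy hx), mul_assoc]
  | star x hx h =>
    have h1 : ⟪ψ, (y * star x) ψ⟫_ℂ = ⟪star y ψ, star x ψ⟫_ℂ := by
      rw [← inner_apply_star_apply, star_star]
    have h2 := h (star_mem hy)
    rw [inner_apply_star_apply] at h2
    have h3 : ⟪ψ, (x * star y) ψ⟫_ℂ = ⟪star x ψ, star y ψ⟫_ℂ := by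
      rw [← inner_apply_star_apply, star_star]
    rw [inner_apply_star_apply, h1, ← inner_conj_symm (x ψ), ← inner_conj_symm (star y ψ), ← h2, h3]

/-- The representation of a *-algebra of operators, on which the vector state of `ψ` is tracial,
on the cyclic subspace of `ψ`; it only depends on the action on `ψ`. -/
lemma StarSubalgebra.exists_cyclic_representation (𝒬 : StarSubalgebra ℂ (H →L[ℂ] H)) (ψ : H)
    (htr : ∀ x ∈ 𝒬, ∀ y ∈ 𝒬, ⟪ψ, (x * y) ψ⟫_ℂ = ⟪ψ, (y * x) ψ⟫_ℂ) :
    ∃ (K : Submodule ℂ H) (_ : CompleteSpace K) (ξ : K) (ρ : 𝒬 →⋆ₐ[ℂ] (K →L[ℂ] K)),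
      (ξ : H) = ψ ∧ (∀ x, ((ρ x ξ : K) : H) = (x : H →L[ℂ] H) ψ) ∧
      ∀ x y : 𝒬, (x : H →L[ℂ] H) ψ = (y : H →L[ℂ] H) ψ → ρ x = ρ y := by
  let V : Submodule ℂ H := (Subalgebra.toSubmodule 𝒬.toSubalgebra).map
    (ContinuousLinearMap.apply ℂ H ψ : (H →L[ℂ] H) →ₗ[ℂ] H)
  let K := V.topologicalClosure
  have hVK : V ≤ K := V.le_topologicalClosure
  have hmem : ∀ x ∈ 𝒬, x ψ ∈ V := fun x hx => ⟨x, hx, rfl⟩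
  have hclosed : IsClosed (K : Set H) := V.isClosed_topologicalClosure
  have hind : ∀ (C : Set H), IsClosed C → (∀ x ∈ 𝒬, x ψ ∈ C) → ∀ k ∈ K, k ∈ C := by
    intro C hC h k hk
    refine closure_minimal ?_ hC hk
    rintro _ ⟨x, hx, rfl⟩
    exact h x hx
  have hinv : ∀ x ∈ 𝒬, ∀ k ∈ K, x k ∈ K := fun x hx =>
    hind (x ⁻¹' K) (hclosed.preimage x.continuous) fun y hy => hVK (hmem (x * y) (mul_mem hx hy))
  have : CompleteSpace K := hclosed.completeSpace_coe
  let ρ : 𝒬 →⋆ₐ[ℂ] (K →L[ℂ] K) :=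
    { toFun := fun x => ((x : H →L[ℂ] H).comp K.subtypeL).codRestrict K
        fun k => hinv x x.2 k k.2
      map_one' := by ext k; rfl
      map_mul' := fun x y => by ext k; rfl
      map_zero' := by ext k; rfl
      map_add' := fun x y => by ext k; rfl
      commutes' := fun r => by ext k; rfl
      map_star' := fun x => by
        rw [ContinuousLinearMap.star_eq_adjoint, ContinuousLinearMap.eq_adjoint_iff]
        intro k l
        exact ContinuousLinearMap.adjoint_inner_left (x : H →L[ℂ] H) (l : H) (k : H) }
  refine ⟨K, this, ⟨ψ, hVK (hmem 1 (one_mem _))⟩, ρ, rfl, fun _ => rfl, fun x y hxy => ?_⟩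
  ext k
  change (x : H →L[ℂ] H) k = (y : H →L[ℂ] H) k
  rw [← sub_eq_zero, ← sub_apply]
  have hD : (x : H →L[ℂ] H) - y ∈ 𝒬 := sub_mem x.2 y.2
  have hDψ : ((x : H →L[ℂ] H) - y) ψ = 0 := by simp [hxy]
  generalize (x : H →L[ℂ] H) - y = D at hD hDψ
  refine hind (D ⁻¹' {0}) (isClosed_singleton.preimage D.continuous) (fun z hz => ?_) k k.2
  rw [Set.mem_preimage, Set.mem_singleton_iff, ← inner_self_eq_zero (𝕜 := ℂ),
    ← mul_apply_eq_comp, ← inner_apply_star_apply, star_mul, ← mul_assoc,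
    htr _ (mul_mem (mul_mem (star_mem hz) (star_mem hD)) hD) _ hz]
  simp [hDψ]

/-- If `Q j b` acts on each `v a` as `1` or `0` according as `b = p j a` or not, then the algebra
contains operators selecting the vectors `v a'` with `p j a' = p j a` for all `j ∈ s`. -/
lemma exists_mem_selecting {α J : Type*} {B : J → Type*} [∀ j, DecidableEq (B j)]
    (𝒬 : StarSubalgebra ℂ (H →L[ℂ] H)) {Q : ∀ j, B j → H →L[ℂ] H} (hQ : ∀ j b, Q j b ∈ 𝒬)
    (p : ∀ j, α → B j) (v : α → H) (s : Finset J)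
    (h : ∀ j ∈ s, ∀ a b, Q j b (v a) = if b = p j a then v a else 0) (a : α) :
    ∃ S ∈ 𝒬, ∀ a', S (v a') = if ∀ j ∈ s, p j a = p j a' then v a' else 0 := by
  classical
  induction s using Finset.induction_on with
  | empty => exact ⟨1, one_mem _, by simp⟩
  | insert j s _ ih =>
    obtain ⟨S, hS, hSv⟩ := ih fun j' hj' => h j' (Finset.mem_insert_of_mem hj')
    refine ⟨Q j (p j a) * S, mul_mem (hQ _ _) hS, fun a' => ?_⟩
    rw [mul_apply_eq_comp, hSv, apply_ite (Q j (p j a)), map_zero,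
      h j (Finset.mem_insert_self j s)]
    simp only [Finset.forall_mem_insert, ← ite_and]
    exact if_congr and_comm rfl rfl

end

/-- A perfect commuting operator strategy for a non-degenerate projection
game (in which every question is asked with positive probability) gives a tracial
correlation, in GNS form: there are a Hilbert space `K`, a unit vector `ξ`, and PVMs of
orthogonal projections such that the vector state of `ξ` is tracial on the generated
unital *-subalgebra and realizes `c`. -/
theorem perfect_commuting_operator_strategy_is_tracial
    {I J : Type} [Fintype I] [Fintype J] [Nonempty I] [Nonempty J]
    {A : I → Type} [∀ i, Fintype (A i)] [∀ i, Nonempty (A i)]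
    {B : J → Type} [∀ j, Fintype (B j)] [∀ j, Nonempty (B j)]
    (μ : I → J → ℝ) (hμ0 : ∀ i j, 0 ≤ μ i j) (hμ1 : ∑ i, ∑ j, μ i j = 1)
    (p : ∀ i j, A i → B j)
    (hnd : ∀ i (a a' : A i), (∀ j, 0 < μ i j → p i j a = p i j a') → a = a')
    (hposI : ∀ i, 0 < ∑ j, μ i j) (hposJ : ∀ j, 0 < ∑ i, μ i j)
    -- `c` is a commuting operator correlation
    {H : Type} [NormedAddCommGroup H] [InnerProductSpace ℂ H] [CompleteSpace H]
    (P : ∀ i, A i → H →L[ℂ] H) (Q : ∀ j, B j → H →L[ℂ] H)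
    (hP : ∀ i a, (P i a).IsPositive) (hPsum : ∀ i, ∑ a, P i a = 1)
    (hQ : ∀ j b, (Q j b).IsPositive) (hQsum : ∀ j, ∑ b, Q j b = 1)
    (hcomm : ∀ i j a b, P i a * Q j b = Q j b * P i a)
    (ψ : H) (hψ : ‖ψ‖ = 1)
    (c : ∀ i j, A i → B j → ℝ)
    (hc : ∀ i j a b, (c i j a b : ℂ) = @inner ℂ H _ ψ ((P i a * Q j b) ψ))
    -- the strategy is perfect
    (hw : ∑ i, ∑ j, μ i j * ∑ a, c i j a (p i j a) = 1) :
    ∃ (K : Type) (_ : NormedAddCommGroup K) (_ : InnerProductSpace ℂ K)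
      (_ : CompleteSpace K) (ξ : K)
      (r : ∀ i, A i → K →L[ℂ] K) (s : ∀ j, B j → K →L[ℂ] K),
      ‖ξ‖ = 1 ∧
      (∀ i a, IsSelfAdjoint (r i a) ∧ r i a * r i a = r i a) ∧ (∀ i, ∑ a, r i a = 1) ∧
      (∀ j b, IsSelfAdjoint (s j b) ∧ s j b * s j b = s j b) ∧ (∀ j, ∑ b, s j b = 1) ∧
      (∀ x y : K →L[ℂ] K,
        x ∈ StarAlgebra.adjoin ℂ ({T | ∃ i a, T = r i a} ∪ {T | ∃ j b, T = s j b}) →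
        y ∈ StarAlgebra.adjoin ℂ ({T | ∃ i a, T = r i a} ∪ {T | ∃ j b, T = s j b}) →
        @inner ℂ K _ ξ ((x * y) ξ) = @inner ℂ K _ ξ ((y * x) ξ)) ∧
      (∀ i j a b, (c i j a b : ℂ) = @inner ℂ K _ ξ ((r i a * s j b) ξ)) := by
  classical
  have hcomm' (i j a b) : Commute (P i a) (Q j b) := hcomm i j a b
  have hcre (i j a b) : c i j a b = (⟪ψ, (P i a * Q j b) ψ⟫_ℂ).re := by
    rw [← hc, Complex.ofReal_re]
  have hwin : ∀ i j, 0 < μ i j → ∑ a, (⟪ψ, (P i a * Q j (p i j a)) ψ⟫_ℂ).re = ‖ψ‖ ^ 2 := by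
    have hle (i j) : ∑ a, c i j a (p i j a) ≤ 1 := by
      have := sum_re_inner_mul_le (hP i) (hPsum i) (hQ j) (hQsum j) (hcomm' i j) (p i j) ψ
      simpa [hcre, hψ] using this
    have hle' (i j) : μ i j * ∑ a, c i j a (p i j a) ≤ μ i j :=
      mul_le_of_le_one_right (hμ0 i j) (hle i j)
    intro i j hij
    have h1 := (Finset.sum_eq_sum_iff_of_le
      fun i _ => Finset.sum_le_sum fun j _ => hle' i j).1 (hw.trans hμ1.symm) i (Finset.mem_univ i)
    have h2 := (Finset.sum_eq_sum_iff_of_le fun j _ => hle' i j).1 h1 j (Finset.mem_univ j)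
    have h3 := (mul_eq_left₀ hij.ne').1 h2
    simpa [hcre, hψ] using h3
  have hPQ (i j) (hij : 0 < μ i j) (a b) : P i a (Q j b ψ) = if b = p i j a then P i a ψ else 0 :=
    povm_apply_apply_of_perfect (hP i) (hPsum i) (hQ j) (hQsum j) (hcomm' i j) (p i j) ψ
      (hwin i j hij) a b
  have hswap (i j a b) : Q j b (P i a ψ) = P i a (Q j b ψ) :=
    (DFunLike.congr_fun (hcomm i j a b) ψ).symm
  have hsumψ (i) : ∑ a, P i a ψ = ψ := by
    rw [← sum_apply, hPsum, one_apply_eq_self]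
  have hex (j) : ∃ i, 0 < μ i j := by
    obtain ⟨i, -, hi⟩ := Finset.exists_lt_of_sum_lt (s := Finset.univ) (f := fun _ => (0 : ℝ))
      (g := fun i => μ i j) (by simpa using hposJ j)
    exact ⟨i, hi⟩
  have hQψ (i j) (hij : 0 < μ i j) (b) : Q j b ψ = ∑ a, if b = p i j a then P i a ψ else 0 := by
    simp_rw [← hPQ i j hij, ← sum_apply, hPsum, one_apply_eq_self]
  have hQQψ (j b) : Q j b (Q j b ψ) = Q j b ψ := by
    obtain ⟨i, hij⟩ := hex j
    conv_lhs => rw [hQψ i j hij]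
    rw [map_sum, hQψ i j hij]
    refine Finset.sum_congr rfl fun a _ => ?_
    split_ifs with h
    · rw [hswap, hPQ i j hij, if_pos h]
    · exact map_zero _
  set 𝒬 := StarAlgebra.adjoin ℂ {T | ∃ j b, T = Q j b}
  have hQmem (j b) : Q j b ∈ 𝒬 := StarAlgebra.subset_adjoin ℂ _ ⟨j, b, rfl⟩
  have hPcomm (i a) {x} (hx : x ∈ 𝒬) : Commute (P i a) x :=
    (hP i a).isSelfAdjoint.commute_of_mem_adjoin
      (by rintro _ ⟨j, b, rfl⟩; exact hcomm' i j a b) hx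
  have htr : ∀ x ∈ 𝒬, ∀ y ∈ 𝒬, ⟪ψ, (x * y) ψ⟫_ℂ = ⟪ψ, (y * x) ψ⟫_ℂ := by
    refine fun x hx y hy => inner_mul_comm_of_mem_adjoin ?_ hx hy
    rintro _ ⟨j, b, rfl⟩
    obtain ⟨i, hij⟩ := hex j
    refine ⟨(hQ j b).isSelfAdjoint, ∑ a with b = p i j a, P i a,
      isSelfAdjoint_sum _ fun a _ => (hP i a).isSelfAdjoint, ?_, ?_⟩
    · rintro _ ⟨j', b', rfl⟩
      exact Commute.sum_left _ _ _ fun a _ => hcomm' i j' a b'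
    · rw [hQψ i j hij, sum_apply, Finset.sum_filter]
  have hS (i a) : ∃ S ∈ 𝒬, ∀ a', S (P i a' ψ) = if a = a' then P i a' ψ else 0 := by
    obtain ⟨S, hS, h⟩ := exists_mem_selecting 𝒬 hQmem (p i) (fun a => P i a ψ)
      {j | 0 < μ i j} (fun j hj a b => by rw [hswap, hPQ i j (by simpa using hj)]) a
    refine ⟨S, hS, fun a' => ?_⟩
    rw [h a']
    by_cases haa : a = a'
    · simp [haa]
    · rw [if_neg haa, if_neg fun hall => haa (hnd i a a' fun j hj => hall j (by simpa using hj))]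
  choose S hSmem hSP using hS
  have hSψ (i a) : S i a ψ = P i a ψ := by
    conv_lhs => rw [← hsumψ i]
    simp [map_sum, hSP]
  have hSstar (i a) : star (S i a) ψ = S i a ψ := by
    have hy : ∀ y ∈ 𝒬, ⟪ψ, (y * star (S i a)) ψ⟫_ℂ = ⟪ψ, (y * S i a) ψ⟫_ℂ := fun y hy => by
      rw [htr _ hy _ (star_mem (hSmem i a)), inner_apply_star_apply, hSψ,
        ← inner_apply_star_apply, (hP i a).isSelfAdjoint.star_eq, (hPcomm i a hy).eq,
        mul_apply_eq_comp, mul_apply_eq_comp, hSψ]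
    have hD := hy _ (star_mem (sub_mem (star_mem (hSmem i a)) (hSmem i a)))
    rw [inner_apply_star_apply, inner_apply_star_apply, ← sub_eq_zero, ← inner_sub_right,
      ← sub_apply, inner_self_eq_zero, sub_apply] at hD
    exact sub_eq_zero.1 hD
  obtain ⟨K, hK, ξ, ρ, hξ, hρξ, hρ⟩ := 𝒬.exists_cyclic_representation ψ htr
  have hinner (x : 𝒬) : ⟪ξ, ρ x ξ⟫_ℂ = ⟪ψ, (x : H →L[ℂ] H) ψ⟫_ℂ := by
    rw [Submodule.coe_inner, hρξ, hξ]
  let r (i : I) (a : A i) : K →L[ℂ] K := ρ ⟨S i a, hSmem i a⟩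
  let s (j : J) (b : B j) : K →L[ℂ] K := ρ ⟨Q j b, hQmem j b⟩
  refine ⟨K, inferInstance, inferInstance, hK, ξ, r, s, ?_, fun i a => ⟨?_, ?_⟩, fun i => ?_,
    fun j b => ⟨?_, ?_⟩, fun j => ?_, ?_, fun i j a b => ?_⟩
  · rw [← hψ, ← hξ, Submodule.coe_norm]
  · exact (map_star ρ _).symm.trans (hρ _ _ (hSstar i a))
  · refine (map_mul ρ _ _).symm.trans (hρ _ _ ?_)
    change S i a (S i a ψ) = S i a ψ
    rw [hSψ, hSP, if_pos rfl]
  · rw [← map_sum, ← map_one ρ]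
    refine hρ _ _ ?_
    rw [AddSubmonoidClass.coe_finsetSum, sum_apply]
    exact (Finset.sum_congr rfl fun a _ => hSψ i a).trans (hsumψ i)
  · exact (map_star ρ _).symm.trans (congrArg ρ (Subtype.ext (hQ j b).isSelfAdjoint.star_eq))
  · exact (map_mul ρ _ _).symm.trans (hρ _ _ (hQQψ j b))
  · rw [← map_sum, ← map_one ρ]
    refine congrArg ρ (Subtype.ext ?_)
    rw [AddSubmonoidClass.coe_finsetSum]
    exact hQsum j
  · have hrange : StarAlgebra.adjoin ℂ ({T | ∃ i a, T = r i a} ∪ {T | ∃ j b, T = s j b})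
        ≤ ρ.range := by
      refine StarAlgebra.adjoin_le ?_
      rintro _ (⟨i, a, rfl⟩ | ⟨j, b, rfl⟩)
      · exact ⟨_, rfl⟩
      · exact ⟨_, rfl⟩
    intro x y hx hy
    obtain ⟨x, rfl⟩ := hrange hx
    obtain ⟨y, rfl⟩ := hrange hy
    change ⟪ξ, (ρ x * ρ y) ξ⟫_ℂ = ⟪ξ, (ρ y * ρ x) ξ⟫_ℂ
    rw [← map_mul, ← map_mul, hinner, hinner]
    exact htr x x.2 y y.2
  · have h : ⟪ξ, (r i a * s j b) ξ⟫_ℂ = ⟪ψ, (S i a * Q j b) ψ⟫_ℂ := by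
      rw [← map_mul, hinner]
      rfl
    rw [h, htr _ (hSmem i a) _ (hQmem j b), hc, hcomm, mul_apply_eq_comp,
      mul_apply_eq_comp, hSψ]
end

section
/- Let G = (I, J, {A_i}, {B_j}, μ, V) be a non-degenerate projection game with projection functions p_{i,j}, in which every question is asked with positive probability, and let c(a,b|i,j) = ⟨ψ, P^i_a Q^j_b ψ⟩ be a commuting operator correlation for G with w_G(c) = 1. Then the tracial data realizing c can be chosen with the additional orthogonality property: there exist a complex Hilbert space K, a unit vector ξ ∈ K, and PVMs {p^i_a}, {q^j_b} of orthogonal projections on K such that ⟨ξ, x y ξ⟩ = ⟨ξ, y x ξ⟩ for all x, y in the unital *-subalgebra generated by all the p^i_a and q^j_b, c(a,b|i,j) = ⟨ξ, p^i_a q^j_b ξ⟩ for all i, j, a, b, and p^i_a q^j_b = 0 whenever μ(i,j) > 0 and p_{i,j}(a) ≠ b. -/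
theorem ContinuousLinearMap.IsPositive.apply_eq_zero_of_inner_eq_zero
    {H : Type*} [NormedAddCommGroup H] [InnerProductSpace ℂ H] [CompleteSpace H]
    {T : H →L[ℂ] H} (hT : T.IsPositive) {x : H} (h : inner ℂ x (T x) = 0) : T x = 0 := by
  obtain ⟨S, rfl⟩ := CStarAlgebra.nonneg_iff_eq_star_mul_self.mp
    ((ContinuousLinearMap.nonneg_iff_isPositive T).mpr hT)
  have hS : S x = 0 := by
    rwa [mul_apply_eq_comp, ContinuousLinearMap.star_eq_adjoint,
      ContinuousLinearMap.adjoint_inner_right, inner_self_eq_zero] at h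
  simp [hS]

/-- A vector state that is tracial on a star subalgebra `S` of operators is a vector state of a
representation of `S` in which the representing vector is separating. -/
theorem StarSubalgebra.exists_starAlgHom_of_tracial_vector
    {H : Type*} [NormedAddCommGroup H] [InnerProductSpace ℂ H] [CompleteSpace H]
    (S : StarSubalgebra ℂ (H →L[ℂ] H)) (ψ : H)
    (htr : ∀ x ∈ S, ∀ y ∈ S, inner ℂ ψ ((x * y) ψ) = inner ℂ ψ ((y * x) ψ)) :
    ∃ (K : Submodule ℂ H) (_ : CompleteSpace K) (ξ : K) (π : S →⋆ₐ[ℂ] (K →L[ℂ] K)),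
      ‖ξ‖ = ‖ψ‖ ∧ (∀ x : S, inner ℂ ξ (π x ξ) = inner ℂ ψ ((x : H →L[ℂ] H) ψ)) ∧
      ∀ x : S, (x : H →L[ℂ] H) ψ = 0 → π x = 0 := by
  set K₀ : Submodule ℂ H :=
    S.toSubalgebra.toSubmodule.map (ContinuousLinearMap.apply ℂ H ψ).toLinearMap with hK₀
  have mem_K₀ : ∀ v, v ∈ K₀ ↔ ∃ y ∈ S, y ψ = v := fun v => by simp [hK₀]
  have hinv : ∀ x : S, ∀ v ∈ K₀.topologicalClosure,
      (x : H →L[ℂ] H) v ∈ K₀.topologicalClosure := fun x v hv =>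
    map_mem_closure (x : H →L[ℂ] H).continuous hv fun w hw => by
      obtain ⟨y, hy, rfl⟩ := (mem_K₀ w).mp hw
      exact (mem_K₀ _).mpr ⟨x * y, mul_mem x.2 hy, rfl⟩
  have hψ : ψ ∈ K₀.topologicalClosure :=
    K₀.le_topologicalClosure ((mem_K₀ ψ).mpr ⟨1, one_mem S, rfl⟩)
  refine ⟨K₀.topologicalClosure, inferInstance, ⟨ψ, hψ⟩,
    { toFun := fun x => (x : H →L[ℂ] H).restrict (hinv x)
      map_one' := rfl
      map_mul' := fun _ _ => rfl
      map_zero' := rfl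
      map_add' := fun _ _ => rfl
      commutes' := fun _ => rfl
      map_star' := fun x => ?_ }, rfl, fun _ => rfl, fun x hx => ?_⟩
  · rw [ContinuousLinearMap.star_eq_adjoint, ContinuousLinearMap.eq_adjoint_iff]
    exact fun v w => ContinuousLinearMap.adjoint_inner_left (x : H →L[ℂ] H) w v
  · ext ⟨v, hv⟩
    refine Set.EqOn.closure (s := (K₀ : Set H)) (f := (x : H →L[ℂ] H)) (g := fun _ => 0)
      (fun w hw => ?_) (x : H →L[ℂ] H).continuous continuous_const hv
    obtain ⟨y, hy, rfl⟩ := (mem_K₀ w).mp hw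
    have h := htr (star y) (star_mem hy) (star (x : H →L[ℂ] H) * x * y)
      (mul_mem (mul_mem (star_mem x.2) x.2) hy)
    have h' := htr (star (x : H →L[ℂ] H) * x) (mul_mem (star_mem x.2) x.2) (y * star y)
      (mul_mem hy (star_mem hy))
    have key : inner ℂ ψ ((star ((x : H →L[ℂ] H) * y) * (x * y)) ψ) = 0 := by
      rw [star_mul, mul_assoc, ← mul_assoc (star (x : H →L[ℂ] H)), h, mul_assoc, h']
      simp [hx]
    rwa [mul_apply_eq_comp, ContinuousLinearMap.star_eq_adjoint,
      ContinuousLinearMap.adjoint_inner_right, inner_self_eq_zero] at key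

section OperatorValuedMeasures

variable {H : Type*} [NormedAddCommGroup H] [InnerProductSpace ℂ H]

theorem povm_sum_apply_sum_apply {A : Type*} [DecidableEq A] {E : A → H →L[ℂ] H} {ψ : H}
    (hE : ∀ a a', E a (E a' ψ) = if a = a' then E a ψ else 0) (F G : Finset A) :
    (∑ a ∈ F, E a) ((∑ a ∈ G, E a) ψ) = (∑ a ∈ F ∩ G, E a) ψ := by
  simp only [sum_apply, map_sum, hE]
  rw [Finset.sum_comm]
  simp [Finset.sum_ite_eq, Finset.sum_ite_mem]

/-- If outcomes `a`, `b` with `f a ≠ b` never occur together, then the second party's operators act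
on `ψ` as the coarse-grained operators of the first party. -/
theorem apply_eq_sum_filter_apply {A B : Type*} [Fintype A] [Fintype B] [DecidableEq B]
    {P : A → H →L[ℂ] H} {Q : B → H →L[ℂ] H} (hPsum : ∑ a, P a = 1) (hQsum : ∑ b, Q b = 1)
    {f : A → B} {ψ : H} (h0 : ∀ a b, f a ≠ b → P a (Q b ψ) = 0) (b : B) :
    Q b ψ = (∑ a with f a = b, P a) ψ := by
  have hP : ∀ a, P a (Q (f a) ψ) = P a ψ := fun a => by
    conv_rhs => rw [← one_apply_eq_self (F := H →L[ℂ] H) ψ, ← hQsum, sum_apply, map_sum]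
    exact (Finset.sum_eq_single (f a) (fun b _ h => h0 a b h.symm) (by simp)).symm
  conv_lhs => rw [← one_apply_eq_self (F := H →L[ℂ] H) (Q b ψ), ← hPsum, sum_apply]
  rw [sum_apply, Finset.sum_filter]
  refine Finset.sum_congr rfl fun a _ => ?_
  split_ifs with h
  · rw [← h, hP]
  · exact h0 a b h

/-- In the situation of `apply_eq_sum_filter_apply`, outcomes `a`, `a'` of the first party that are
told apart by `f` are orthogonal on `ψ`. -/
theorem inner_apply_apply_eq_zero_of_ne {A B : Type*} [Fintype B]
    {P : A → H →L[ℂ] H} {Q : B → H →L[ℂ] H}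
    (hQ : ∀ b, (Q b).IsPositive) (hQsum : ∑ b, Q b = 1) (hcomm : ∀ a b, Commute (P a) (Q b))
    {f : A → B} {ψ : H} (h0 : ∀ a b, f a ≠ b → P a (Q b ψ) = 0) {a a' : A} (h : f a ≠ f a') :
    inner ℂ (P a ψ) (P a' ψ) = 0 := by
  have hswap : ∀ a b v, P a (Q b v) = Q b (P a v) := fun a b v =>
    DFunLike.congr_fun (hcomm a b).eq v
  have hPa' : P a' ψ = Q (f a') (P a' ψ) := by
    conv_lhs => rw [← one_apply_eq_self (F := H →L[ℂ] H) (P a' ψ), ← hQsum, sum_apply]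
    refine Finset.sum_eq_single (f a') (fun b _ hb => ?_) (by simp)
    rw [← hswap, h0 a' b hb.symm]
  rw [hPa', ← (hQ _).inner_left_eq_inner_right, ← hswap, h0 a _ h, inner_zero_left]

variable [CompleteSpace H]

open scoped ComplexOrder in
/-- The members of a POVM whose images of `ψ` are pairwise orthogonal act on `ψ` like pairwise
orthogonal projections. -/
theorem povm_apply_apply_of_pairwise_orthogonal {A : Type*} [Fintype A] [DecidableEq A]
    {E : A → H →L[ℂ] H} (hE : ∀ a, (E a).IsPositive) (hsum : ∑ a, E a = 1) {ψ : H}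
    (horth : ∀ a a', a ≠ a' → inner ℂ (E a ψ) (E a' ψ) = 0) (a a' : A) :
    E a (E a' ψ) = if a = a' then E a ψ else 0 := by
  have hidem : ∀ a, E a (E a ψ) = E a ψ := fun a => by
    have hcompl : (1 - E a).IsPositive := by
      rw [← hsum, ← Finset.add_sum_erase _ _ (Finset.mem_univ a), add_sub_cancel_left]
      exact ContinuousLinearMap.isPositive_sum _ fun i _ => hE i
    have hpos : ((1 - E a) * E a).IsPositive := by
      rw [← ContinuousLinearMap.nonneg_iff_isPositive] at hcompl ⊢
      exact Commute.mul_nonneg hcompl ((ContinuousLinearMap.nonneg_iff_isPositive _).mpr (hE a))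
        ((Commute.one_left _).sub_left (Commute.refl _))
    have hinner : inner ℂ ψ (E a ψ) = inner ℂ (E a ψ) (E a ψ) := by
      calc inner ℂ ψ (E a ψ) = inner ℂ (∑ a', E a' ψ) (E a ψ) := by
            rw [← sum_apply, hsum, one_apply_eq_self]
        _ = inner ℂ (E a ψ) (E a ψ) := by
            rw [sum_inner]
            exact Finset.sum_eq_single a (fun a' _ h => horth a' a h)
              (fun h => absurd (Finset.mem_univ a) h)
    have h0 : inner ℂ ψ (((1 - E a) * E a) ψ) = 0 := by
      simp only [mul_apply_eq_comp, sub_apply, one_apply_eq_self, inner_sub_right]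
      rw [hinner, (hE a).inner_left_eq_inner_right, sub_self]
    have := hpos.apply_eq_zero_of_inner_eq_zero h0
    simp only [mul_apply_eq_comp, sub_apply, one_apply_eq_self] at this
    exact (sub_eq_zero.mp this).symm
  split_ifs with h
  · rw [← h, hidem]
  · refine (hE a).apply_eq_zero_of_inner_eq_zero ?_
    have h0 : ∑ i ∈ Finset.univ.erase a', inner ℂ (E a' ψ) (E i (E a' ψ)) = 0 := by
      rw [← inner_sum, ← sum_apply, ← add_right_inj (inner ℂ (E a' ψ) (E a' (E a' ψ))),
        ← inner_add_right, ← add_apply, Finset.add_sum_erase _ _ (Finset.mem_univ a'), hsum,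
        hidem, add_zero, one_apply_eq_self]
    exact (Finset.sum_eq_zero_iff_of_nonneg fun i _ => (hE i).inner_nonneg_right _).mp h0 a
      (Finset.mem_erase.mpr ⟨h, Finset.mem_univ a⟩)

/-- If the coarse-grainings of a POVM in `S` along functions that jointly separate outcomes act on
`ψ` like self-adjoint operators commuting with `S`, then the POVM lies in the centralizer of the
vector state of `ψ` on `S`. -/
theorem inner_mul_comm_of_separating_coarsenings {A J : Type*} [Fintype A] {B : J → Type*}
    [DecidableEq A] [∀ j, DecidableEq (B j)] (S : StarSubalgebra ℂ (H →L[ℂ] H))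
    {E : A → H →L[ℂ] H} (hmem : ∀ a, E a ∈ S) (hE : ∀ a, (E a).IsPositive)
    (hsum : ∑ a, E a = 1) {ψ : H} (hEE : ∀ a a', E a (E a' ψ) = if a = a' then E a ψ else 0)
    {Q : ∀ j, B j → H →L[ℂ] H} (hQ : ∀ j b, (Q j b).IsPositive)
    (hcomm : ∀ j b, ∀ x ∈ S, Commute x (Q j b)) (f : ∀ j, A → B j) (N : Finset J)
    (hQE : ∀ j ∈ N, ∀ b, Q j b ψ = (∑ a with f j a = b, E a) ψ)
    (hsep : ∀ a a', (∀ j ∈ N, f j a = f j a') → a = a') (a : A) :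
    ∀ x ∈ S, inner ℂ ψ ((x * E a) ψ) = inner ℂ ψ ((E a * x) ψ) := by
  classical
  have hpos : ∀ F : Finset A, (∑ a ∈ F, E a).IsPositive := fun F =>
    ContinuousLinearMap.isPositive_sum _ fun i _ => hE i
  have hFmem : ∀ F : Finset A, ∑ a ∈ F, E a ∈ S := fun F => sum_mem fun i _ => hmem i
  have hinter : ∀ F G : Finset A,
      (∀ x ∈ S, inner ℂ ψ ((x * ∑ a ∈ F, E a) ψ) = inner ℂ ψ (((∑ a ∈ F, E a) * x) ψ)) →
      (∀ x ∈ S, inner ℂ ψ ((x * ∑ a ∈ G, E a) ψ) = inner ℂ ψ (((∑ a ∈ G, E a) * x) ψ)) →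
      ∀ x ∈ S, inner ℂ ψ ((x * ∑ a ∈ F ∩ G, E a) ψ) =
        inner ℂ ψ (((∑ a ∈ F ∩ G, E a) * x) ψ) := fun F G hF hG x hx => by
    have h₁ := hG _ (mul_mem hx (hFmem F))
    have h₂ := hF _ (mul_mem (hFmem G) hx)
    rw [← mul_assoc (∑ a ∈ G, E a), h₂] at h₁
    simp only [mul_apply_eq_comp, ← (hpos _).inner_left_eq_inner_right,
      povm_sum_apply_sum_apply hEE] at h₁ ⊢
    rw [h₁, Finset.inter_comm]
  have hfilter : ∀ L : Finset J, L ⊆ N → ∀ x ∈ S,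
      inner ℂ ψ ((x * ∑ a' with ∀ j ∈ L, f j a' = f j a, E a') ψ) =
        inner ℂ ψ (((∑ a' with ∀ j ∈ L, f j a' = f j a, E a') * x) ψ) := fun L => by
    induction L using Finset.induction_on with
    | empty => simp [hsum]
    | insert j L hj ih =>
      intro hL
      have hset : ({a' | ∀ k ∈ insert j L, f k a' = f k a} : Finset A) =
          ({a' | f j a' = f j a} : Finset A) ∩ ({a' | ∀ k ∈ L, f k a' = f k a} : Finset A) := by
        ext; simp
      rw [hset]
      refine hinter _ _ (fun x hx => ?_) (ih ((Finset.subset_insert j L).trans hL))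
      have hj : Q j (f j a) ψ = _ := hQE j (hL (Finset.mem_insert_self j L)) (f j a)
      rw [mul_apply_eq_comp, mul_apply_eq_comp, ← (hpos _).inner_left_eq_inner_right, ← hj,
        (hQ _ _).inner_left_eq_inner_right]
      exact congrArg _ (DFunLike.congr_fun (hcomm j (f j a) x hx).eq ψ)
  have hsingle : ({a' | ∀ j ∈ N, f j a' = f j a} : Finset A) = {a} := by
    ext a'
    simpa using ⟨hsep a' a, by rintro rfl; simp⟩
  simpa [hsingle] using hfilter N subset_rfl

/-- A vector state on a star subalgebra generated by self-adjoint elements of its centralizer is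
tracial. -/
theorem inner_mul_comm_of_generators (s : Set (H →L[ℂ] H)) (ψ : H)
    (h : ∀ y ∈ s, ∀ x ∈ StarAlgebra.adjoin ℂ s, inner ℂ ψ ((x * y) ψ) = inner ℂ ψ ((y * x) ψ)) :
    ∀ x ∈ StarAlgebra.adjoin ℂ s, ∀ y ∈ StarAlgebra.adjoin ℂ s,
      inner ℂ ψ ((x * y) ψ) = inner ℂ ψ ((y * x) ψ) := by
  intro x hx y hy
  induction hy using StarAlgebra.adjoin_induction generalizing x with
  | mem y hy => exact h y hy x hx
  | algebraMap c => rw [Algebra.commutes]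
  | add y z _ _ hy hz => simp only [mul_add, add_mul, add_apply, inner_add_right, hy x hx, hz x hx]
  | mul y z hy' hz' hy hz =>
    rw [← mul_assoc, hz _ (mul_mem hx hy'), ← mul_assoc, hy _ (mul_mem hz' hx), mul_assoc]
  | star y hy' hy =>
    have hstar : ∀ T : H →L[ℂ] H, inner ℂ ψ ((star T) ψ) = starRingEnd ℂ (inner ℂ ψ (T ψ)) :=
      fun T => by
        rw [ContinuousLinearMap.star_eq_adjoint, ContinuousLinearMap.adjoint_inner_right,
          inner_conj_symm]
    have hxy : x * star y = star (y * star x) := by simp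
    have hyx : star y * x = star (star x * y) := by simp
    rw [hxy, hyx, hstar, hstar, hy _ (star_mem hx)]

end OperatorValuedMeasures

/-- A correlation that wins a projection game perfectly assigns no weight to losing answers. -/
theorem eq_zero_of_winning_probability_eq_one {I J : Type*} [Fintype I] [Fintype J]
    {A : I → Type*} [∀ i, Fintype (A i)] {B : J → Type*} [∀ j, Fintype (B j)]
    {μ : I → J → ℝ} (hμ0 : ∀ i j, 0 ≤ μ i j) (hμ1 : ∑ i, ∑ j, μ i j = 1)
    (p : ∀ i j, A i → B j) {c : ∀ i j, A i → B j → ℝ} (hc0 : ∀ i j a b, 0 ≤ c i j a b)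
    (hc1 : ∀ i j, ∑ a, ∑ b, c i j a b = 1)
    (hw : ∑ i, ∑ j, μ i j * ∑ a, c i j a (p i j a) = 1)
    {i : I} {j : J} (hμ : 0 < μ i j) {a : A i} {b : B j} (hab : p i j a ≠ b) :
    c i j a b = 0 := by
  classical
  have hle : ∀ i j a, c i j a (p i j a) ≤ ∑ b, c i j a b := fun i j a =>
    Finset.single_le_sum (fun b _ => hc0 i j a b) (Finset.mem_univ _)
  have hle1 : ∀ i j, μ i j * ∑ a, c i j a (p i j a) ≤ μ i j := fun i j =>
    mul_le_of_le_one_right (hμ0 i j) ((Finset.sum_le_sum fun a _ => hle i j a).trans_eq (hc1 i j))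
  have hi := (Finset.sum_eq_sum_iff_of_le fun i _ => Finset.sum_le_sum fun j _ => hle1 i j).mp
    (hw.trans hμ1.symm) i (Finset.mem_univ i)
  have hj := (Finset.sum_eq_sum_iff_of_le fun j _ => hle1 i j).mp hi j (Finset.mem_univ j)
  have hsum : ∑ a, c i j a (p i j a) = ∑ a, ∑ b, c i j a b := by
    rw [hc1]
    exact mul_left_cancel₀ hμ.ne' (hj.trans (mul_one _).symm)
  have ha := (Finset.sum_eq_sum_iff_of_le fun a _ => hle i j a).mp hsum a (Finset.mem_univ a)
  rw [← Finset.add_sum_erase _ _ (Finset.mem_univ (p i j a)), left_eq_add] at ha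
  exact (Finset.sum_eq_zero_iff_of_nonneg fun b _ => hc0 i j a b).mp ha b
    (Finset.mem_erase.mpr ⟨hab.symm, Finset.mem_univ b⟩)


/-- A perfect commuting operator strategy for a non-degenerate projection
game (in which every question is asked with positive probability) gives a tracial
correlation, in GNS form: there are a Hilbert space `K`, a unit vector `ξ`, and PVMs of
orthogonal projections such that the vector state of `ξ` is tracial on the generated
unital *-subalgebra and realizes `c`, and moreover `p^i_a q^j_b = 0` whenever
`μ i j > 0` and `p i j a ≠ b`. -/
theorem perfect_commuting_operator_strategy_is_tracial_orthogonal
    {I J : Type} [Fintype I] [Fintype J] [Nonempty I] [Nonempty J]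
    {A : I → Type} [∀ i, Fintype (A i)] [∀ i, Nonempty (A i)]
    {B : J → Type} [∀ j, Fintype (B j)] [∀ j, Nonempty (B j)]
    (μ : I → J → ℝ) (hμ0 : ∀ i j, 0 ≤ μ i j) (hμ1 : ∑ i, ∑ j, μ i j = 1)
    (p : ∀ i j, A i → B j)
    (hnd : ∀ i (a a' : A i), (∀ j, 0 < μ i j → p i j a = p i j a') → a = a')
    (hposI : ∀ i, 0 < ∑ j, μ i j) (hposJ : ∀ j, 0 < ∑ i, μ i j)
    -- `c` is a commuting operator correlation
    {H : Type} [NormedAddCommGroup H] [InnerProductSpace ℂ H] [CompleteSpace H]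
    (P : ∀ i, A i → H →L[ℂ] H) (Q : ∀ j, B j → H →L[ℂ] H)
    (hP : ∀ i a, (P i a).IsPositive) (hPsum : ∀ i, ∑ a, P i a = 1)
    (hQ : ∀ j b, (Q j b).IsPositive) (hQsum : ∀ j, ∑ b, Q j b = 1)
    (hcomm : ∀ i j a b, P i a * Q j b = Q j b * P i a)
    (ψ : H) (hψ : ‖ψ‖ = 1)
    (c : ∀ i j, A i → B j → ℝ)
    (hc : ∀ i j a b, (c i j a b : ℂ) = @inner ℂ H _ ψ ((P i a * Q j b) ψ))
    -- the strategy is perfect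
    (hw : ∑ i, ∑ j, μ i j * ∑ a, c i j a (p i j a) = 1) :
    ∃ (K : Type) (_ : NormedAddCommGroup K) (_ : InnerProductSpace ℂ K)
      (_ : CompleteSpace K) (ξ : K)
      (r : ∀ i, A i → K →L[ℂ] K) (s : ∀ j, B j → K →L[ℂ] K),
      ‖ξ‖ = 1 ∧
      (∀ i a, IsSelfAdjoint (r i a) ∧ r i a * r i a = r i a) ∧ (∀ i, ∑ a, r i a = 1) ∧
      (∀ j b, IsSelfAdjoint (s j b) ∧ s j b * s j b = s j b) ∧ (∀ j, ∑ b, s j b = 1) ∧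
      (∀ x y : K →L[ℂ] K,
        x ∈ StarAlgebra.adjoin ℂ ({T | ∃ i a, T = r i a} ∪ {T | ∃ j b, T = s j b}) →
        y ∈ StarAlgebra.adjoin ℂ ({T | ∃ i a, T = r i a} ∪ {T | ∃ j b, T = s j b}) →
        @inner ℂ K _ ξ ((x * y) ξ) = @inner ℂ K _ ξ ((y * x) ξ)) ∧
      (∀ i j a b, (c i j a b : ℂ) = @inner ℂ K _ ξ ((r i a * s j b) ξ)) ∧
      (∀ i j a b, 0 < μ i j → p i j a ≠ b → r i a * s j b = 0) := by
  classical
  set S : StarSubalgebra ℂ (H →L[ℂ] H) := StarAlgebra.adjoin ℂ {T | ∃ i a, T = P i a}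
  have hPS : ∀ i a, P i a ∈ S := fun i a => StarAlgebra.subset_adjoin ℂ _ ⟨i, a, rfl⟩
  have hQS : ∀ j b, ∀ x ∈ S, Commute x (Q j b) := fun j b x hx => by
    have hle : S ≤ StarSubalgebra.centralizer ℂ {Q j b} := by
      refine StarAlgebra.adjoin_le ?_
      rintro _ ⟨i, a, rfl⟩
      refine (StarSubalgebra.mem_centralizer_iff ℂ).mpr ?_
      simp [(hQ j b).isSelfAdjoint.star_eq, hcomm]
    exact (((StarSubalgebra.mem_centralizer_iff ℂ).mp (hle hx)) _ rfl).1.symm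
  have hPQ : ∀ i j a b, (P i a * Q j b).IsPositive := fun i j a b => by
    rw [← ContinuousLinearMap.nonneg_iff_isPositive]
    exact Commute.mul_nonneg ((ContinuousLinearMap.nonneg_iff_isPositive _).mpr (hP i a))
      ((ContinuousLinearMap.nonneg_iff_isPositive _).mpr (hQ j b)) (hcomm i j a b)
  have hc0 : ∀ i j a b, 0 ≤ c i j a b := fun i j a b => by
    have h := (hPQ i j a b).re_inner_nonneg_right ψ
    rwa [← hc] at h
  have hc1 : ∀ i j, ∑ a, ∑ b, c i j a b = 1 := fun i j => by
    have h : ((∑ a, ∑ b, c i j a b : ℝ) : ℂ) = 1 := by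
      push_cast
      simp_rw [hc, ← inner_sum, ← sum_apply, ← Finset.mul_sum, hQsum, mul_one, hPsum]
      simp [hψ]
    exact_mod_cast h
  have hzero : ∀ i j, 0 < μ i j → ∀ a b, p i j a ≠ b → P i a (Q j b ψ) = 0 :=
    fun i j hij a b hab => (hPQ i j a b).apply_eq_zero_of_inner_eq_zero (by
      rw [← hc, eq_zero_of_winning_probability_eq_one hμ0 hμ1 p hc0 hc1 hw hij hab,
        Complex.ofReal_zero])
  have hQP : ∀ i j, 0 < μ i j → ∀ b, Q j b ψ = (∑ a with p i j a = b, P i a) ψ :=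
    fun i j hij => apply_eq_sum_filter_apply (hPsum i) (hQsum j) (hzero i j hij)
  have hPP : ∀ i a a', P i a (P i a' ψ) = if a = a' then P i a ψ else 0 := fun i => by
    refine povm_apply_apply_of_pairwise_orthogonal (hP i) (hPsum i) fun a a' haa' => ?_
    obtain ⟨j, hij, hj⟩ : ∃ j, 0 < μ i j ∧ p i j a ≠ p i j a' := by
      by_contra! h
      exact haa' (hnd i a a' h)
    exact inner_apply_apply_eq_zero_of_ne (hQ j) (hQsum j) (hcomm i j) (hzero i j hij) hj
  have htr : ∀ x ∈ S, ∀ y ∈ S, inner ℂ ψ ((x * y) ψ) = inner ℂ ψ ((y * x) ψ) := by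
    refine inner_mul_comm_of_generators _ ψ ?_
    rintro _ ⟨i, a, rfl⟩
    exact inner_mul_comm_of_separating_coarsenings S (hPS i) (hP i) (hPsum i) (hPP i) hQ hQS (p i)
      {j | 0 < μ i j} (fun j hj => hQP i j (by simpa using hj))
      (fun a a' h => hnd i a a' (by simpa using h)) a
  have hex : ∀ j, ∃ i, 0 < μ i j := fun j => by
    by_contra! h
    exact (hposJ j).not_ge (Finset.sum_nonpos fun i _ => h i)
  choose k hk using hex
  obtain ⟨K, _, ξ, π, hξ, hstate, hsep⟩ := S.exists_starAlgHom_of_tracial_vector ψ htr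
  have hπ : ∀ x y : S, (x : H →L[ℂ] H) ψ = (y : H →L[ℂ] H) ψ → π x = π y := fun x y h => by
    rw [← sub_eq_zero, ← map_sub]
    exact hsep _ (by simp [h])
  let P' : ∀ i, A i → S := fun i a => ⟨P i a, hPS i a⟩
  let R : ∀ j, B j → S := fun j b => ∑ a with p (k j) j a = b, P' (k j) a
  have hR : ∀ j b, (R j b : H →L[ℂ] H) = ∑ a with p (k j) j a = b, P (k j) a := fun j b => by
    simp [R, P']
  have hRψ : ∀ j b, (R j b : H →L[ℂ] H) ψ = Q j b ψ := fun j b => by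
    rw [hR, hQP (k j) j (hk j)]
  have hP'sum : ∀ i, ∑ a, P' i a = 1 := fun i => Subtype.ext (by simp [P', hPsum])
  have hP'sa : ∀ i a, IsSelfAdjoint (P' i a) := fun i a => Subtype.ext (hP i a).isSelfAdjoint
  refine ⟨K, inferInstance, inferInstance, inferInstance, ξ, fun i a => π (P' i a),
    fun j b => π (R j b), hξ.trans hψ, fun i a => ⟨(hP'sa i a).map π, ?_⟩, fun i => ?_,
    fun j b => ⟨(isSelfAdjoint_sum _ fun a _ => hP'sa (k j) a).map π, ?_⟩, fun j => ?_,
    fun x y hx hy => ?_, fun i j a b => ?_, fun i j a b hij hab => ?_⟩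
  · rw [← map_mul]
    exact hπ _ _ (by simp [P', hPP])
  · rw [← map_sum, hP'sum, map_one]
  · rw [← map_mul]
    refine hπ _ _ ?_
    rw [MulMemClass.coe_mul, mul_apply_eq_comp, hR, povm_sum_apply_sum_apply (hPP (k j)),
      Finset.inter_self]
  · rw [← map_sum, Finset.sum_fiberwise Finset.univ (p (k j) j) (P' (k j)), hP'sum, map_one]
  · have hrange : StarAlgebra.adjoin ℂ ({T | ∃ i a, T = π (P' i a)} ∪ {T | ∃ j b, T = π (R j b)}) ≤
        π.range := by
      refine StarAlgebra.adjoin_le ?_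
      rintro _ (⟨i, a, rfl⟩ | ⟨j, b, rfl⟩)
      exacts [⟨_, rfl⟩, ⟨_, rfl⟩]
    obtain ⟨x, rfl⟩ := hrange hx
    obtain ⟨y, rfl⟩ := hrange hy
    change inner ℂ ξ ((π x * π y) ξ) = inner ℂ ξ ((π y * π x) ξ)
    rw [← map_mul, ← map_mul, hstate, hstate]
    exact htr x x.2 y y.2
  · rw [← map_mul, hstate, MulMemClass.coe_mul, mul_apply_eq_comp, hRψ, hc, mul_apply_eq_comp]
  · rw [← map_mul]
    refine hsep _ ?_
    rw [MulMemClass.coe_mul, mul_apply_eq_comp, hRψ]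
    exact hzero i j hij a b hab
end

section
/- Let H be a complex Hilbert space, M a von Neumann algebra acting on H, ξ ∈ H a unit vector, and let ρ(x) = ⟨ξ, x ξ⟩ be the associated (normal) vector state on M. Let S be a finite set and {a_s}_{s∈S} ⊆ M a POVM (each a_s positive, Σ_s a_s = 1) such that Σ_{s∈S} ρ(a_s²) ≥ 1 − ε for some ε ≥ 0. Then there exists a PVM {p_s}_{s∈S} ⊆ M (each p_s an orthogonal projection in M, Σ_s p_s = 1) such that Σ_{s∈S} ρ((a_s − p_s)²) ≤ 9ε. -/
section Rounding

open ContinuousLinearMap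

variable {K : Type*} [NormedAddCommGroup K] [InnerProductSpace ℂ K] [CompleteSpace K]

/-- The projection onto the kernel of a self-adjoint `N` lies in the bicommutant of `N`. -/
theorem commute_starProjection_ker {N A : K →L[ℂ] K} (hN : IsSelfAdjoint N) (hA : Commute A N) :
    Commute A N.ker.starProjection := by
  have key : ∀ B : K →L[ℂ] K, Commute B N →
      N.ker.starProjection * B * N.ker.starProjection = B * N.ker.starProjection := by
    intro B hB
    ext v
    change N.ker.starProjection (B (N.ker.starProjection v)) = B (N.ker.starProjection v)
    rw [Submodule.starProjection_eq_self_iff]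
    have : N (N.ker.starProjection v) = 0 := (N.ker.starProjection_apply_mem v)
    have h2 := DFunLike.congr_fun hB.eq (N.ker.starProjection v)
    change B (N _) = N (B _) at h2
    rw [this, map_zero] at h2
    exact h2.symm
  have hQ : IsSelfAdjoint N.ker.starProjection := isSelfAdjoint_starProjection _
  have hA' : Commute (star A) N := by
    have := hA.star_star
    rwa [hN.star_eq] at this
  have h1 := key A hA
  have h2 := congr_arg star (key _ hA')
  simp only [star_mul, star_star, hQ.star_eq] at h2
  rw [mul_assoc] at h1
  exact h1.symm.trans h2

/-- The spectral projection of a positive contraction `T` at threshold `1 / 2`. -/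
theorem exists_isStarProjection_le_two_smul {T : K →L[ℂ] K} (h0 : 0 ≤ T) (h1 : T ≤ 1) :
    ∃ Q : K →L[ℂ] K, IsStarProjection Q ∧ (∀ A, Commute A T → Commute A Q) ∧
      Q ≤ T + T ∧ T + T ≤ 1 + Q := by
  have hT : IsSelfAdjoint T := .of_nonneg h0
  set S : K →L[ℂ] K := T + T - 1 with hS
  have hSa : IsSelfAdjoint S := (hT.add hT).sub (.one _)
  have hNa : IsSelfAdjoint S⁻ := .of_nonneg (CFC.negPart_nonneg S)
  set Q := (S⁻).ker.starProjection with hQ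
  have hQp : IsStarProjection Q := isStarProjection_starProjection
  have hcomm : ∀ A, Commute A T → Commute A Q := by
    intro A hA
    refine commute_starProjection_ker hNa ?_
    have : Commute A S := (hA.add_right hA).sub_right (Commute.one_right A)
    exact (this.symm.cfcₙ_real _).symm
  have hNQ : S⁻ * Q = 0 := by
    ext v
    exact (S⁻).ker.starProjection_apply_mem v
  have hQP : Q * S⁺ = S⁺ := by
    ext v
    change Q (S⁺ v) = S⁺ v
    rw [hQ, Submodule.starProjection_eq_self_iff]
    exact DFunLike.congr_fun (CFC.negPart_mul_posPart S) v
  have hsub : S⁺ - S⁻ = S := CFC.posPart_sub_negPart S hSa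
  have hTQ : T * Q = Q * T := (hcomm T (Commute.refl T)).eq
  have hQQ : Q * Q = Q := hQp.isIdempotentElem
  have hQs : IsSelfAdjoint Q := hQp.isSelfAdjoint
  have e1 : T + T - Q = Q * S⁺ * Q + (1 - Q) * (T + T) * (1 - Q) := by
    have : Q * S⁺ * Q = Q * S * Q := by
      conv_rhs => rw [← hsub, mul_sub, sub_mul, mul_assoc Q S⁻, hNQ, mul_zero, sub_zero]
    rw [this, hS]
    have h3 : Q * T * Q = Q * T := by rw [mul_assoc, hTQ, ← mul_assoc, hQQ]
    simp only [mul_sub, sub_mul, mul_add, add_mul, h3, hTQ, hQQ, mul_one, one_mul]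
    abel
  have e2 : 1 + Q - (T + T) = Q * ((1 - T) + (1 - T)) * Q + (1 - Q) * S⁻ * (1 - Q) := by
    have : (1 - Q) * S⁻ * (1 - Q) = - ((1 - Q) * S * (1 - Q)) := by
      conv_rhs => rw [← hsub, mul_sub (1 - Q), sub_mul 1 Q S⁺, hQP]
      simp
    rw [this, hS]
    have h3 : Q * T * Q = Q * T := by rw [mul_assoc, hTQ, ← mul_assoc, hQQ]
    simp only [mul_sub, sub_mul, mul_add, add_mul, h3, hTQ, hQQ, mul_one, one_mul]
    abel
  refine ⟨Q, hQp, hcomm, ?_, ?_⟩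
  · rw [← sub_nonneg, e1]
    exact add_nonneg (hQs.conjugate_nonneg (CFC.posPart_nonneg S))
      (((IsSelfAdjoint.one _).sub hQs).conjugate_nonneg (add_nonneg h0 h0))
  · rw [← sub_nonneg, e2]
    exact add_nonneg (hQs.conjugate_nonneg (add_nonneg (sub_nonneg.2 h1) (sub_nonneg.2 h1)))
      (((IsSelfAdjoint.one _).sub hQs).conjugate_nonneg (CFC.negPart_nonneg S))

theorem IsStarProjection.re_inner_apply_self {Q : K →L[ℂ] K} (hQ : IsStarProjection Q) (v : K) :
    (inner ℂ v (Q v)).re = ‖Q v‖ ^ 2 := by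
  have h1 : Q (Q v) = Q v := DFunLike.congr_fun hQ.isIdempotentElem.eq v
  have h2 := adjoint_inner_left Q (Q v) v
  rw [← star_eq_adjoint, hQ.isSelfAdjoint.star_eq, h1] at h2
  rw [← h2, inner_self_eq_norm_sq_to_K]
  norm_cast

theorem IsStarProjection.norm_sub_apply_sq {Q : K →L[ℂ] K} (hQ : IsStarProjection Q) (v : K) :
    ‖v - Q v‖ ^ 2 = ‖v‖ ^ 2 - ‖Q v‖ ^ 2 := by
  have h := hQ.re_inner_apply_self v
  have := norm_sub_sq (𝕜 := ℂ) v (Q v)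
  simp only [RCLike.re_to_complex] at this
  linarith

theorem re_inner_le_of_le {A B : K →L[ℂ] K} (h : A ≤ B) (v : K) :
    (inner ℂ v (A v)).re ≤ (inner ℂ v (B v)).re := by
  have := (ContinuousLinearMap.le_def A B).1 h |>.re_inner_nonneg_right v
  simp only [sub_apply, inner_sub_right, map_sub, RCLike.re_to_complex] at this
  linarith

/-- A real linear functional does not decrease from a positive contraction to a suitable
spectral projection of it: some binary digit of `T` is at least as good as `T`. -/
theorem exists_isStarProjection_ge {T : K →L[ℂ] K} (h0 : 0 ≤ T) (h1 : T ≤ 1)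
    (ω : (K →L[ℂ] K) →L[ℝ] ℝ) :
    ∃ Q : K →L[ℂ] K, IsStarProjection Q ∧ (∀ A, Commute A T → Commute A Q) ∧
      (∀ v, T v = 0 → Q v = 0) ∧ (∀ v, T v = v → Q v = v) ∧ ω T ≤ ω Q := by
  by_contra! hno
  let P : (K →L[ℂ] K) → Prop := fun R ↦ 0 ≤ R ∧ R ≤ 1 ∧ (∀ A, Commute A T → Commute A R) ∧
    (∀ v, T v = 0 → R v = 0) ∧ (∀ v, T v = v → R v = v)
  have step : ∀ R, P R → ∃ R', P R' ∧ 2 * (ω R - ω T) < ω R' - ω T := by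
    rintro R ⟨hR0, hR1, hRc, hRz, hRo⟩
    obtain ⟨Q, hQ, hQc, hQl, hQu⟩ := exists_isStarProjection_le_two_smul hR0 hR1
    have hz : ∀ v, T v = 0 → Q v = 0 := by
      intro v hv
      have := re_inner_le_of_le hQl v
      rw [hQ.re_inner_apply_self, add_apply, hRz v hv] at this
      simp only [add_zero, inner_zero_right, Complex.zero_re] at this
      simpa using this
    have ho : ∀ v, T v = v → Q v = v := by
      intro v hv
      have := re_inner_le_of_le hQu v
      rw [add_apply, add_apply, hRo v hv, one_apply_eq_self, inner_add_right, inner_add_right,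
        Complex.add_re, Complex.add_re, hQ.re_inner_apply_self] at this
      have h3 := hQ.norm_sub_apply_sq v
      have h4 : (inner ℂ v v).re = ‖v‖ ^ 2 := by
        rw [inner_self_eq_norm_sq_to_K]; norm_cast
      have h5 : ‖v - Q v‖ ^ 2 ≤ 0 := by linarith
      have h6 : v - Q v = 0 := by simpa using h5
      exact (sub_eq_zero.1 h6).symm
    have hc : ∀ A, Commute A T → Commute A Q := fun A hA ↦ hQc A (hRc A hA)
    refine ⟨R + R - Q, ⟨sub_nonneg.2 hQl, ?_, ?_, ?_, ?_⟩, ?_⟩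
    · rw [sub_le_iff_le_add]; exact hQu
    · exact fun A hA ↦ ((hRc A hA).add_right (hRc A hA)).sub_right (hc A hA)
    · intro v hv; simp [hRz v hv, hz v hv]
    · intro v hv; simp [hRo v hv, ho v hv]
    · have := hno Q hQ hc hz ho
      rw [map_sub, map_add]; linarith
  obtain ⟨R₀, hR₀, hδ⟩ := step T ⟨h0, h1, fun _ h ↦ h, fun _ h ↦ h, fun _ h ↦ h⟩
  have hδ' : 0 < ω R₀ - ω T := by simpa using hδ
  have iter : ∀ n : ℕ, ∃ R, P R ∧ 2 ^ n * (ω R₀ - ω T) ≤ ω R - ω T := by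
    intro n
    induction n with
    | zero => exact ⟨R₀, hR₀, by simp⟩
    | succ n ih =>
      obtain ⟨R, hR, hn⟩ := ih
      obtain ⟨R', hR', hn'⟩ := step R hR
      exact ⟨R', hR', by rw [pow_succ]; linarith⟩
  have bound : ∀ R, P R → ω R ≤ ‖ω‖ := by
    rintro R ⟨hR0, hR1, -⟩
    have hR : ‖R‖ ≤ 1 := CStarAlgebra.norm_le_one_iff_of_nonneg R hR0 |>.2 hR1
    calc ω R ≤ ‖ω R‖ := Real.le_norm_self _
      _ ≤ ‖ω‖ * ‖R‖ := ω.le_opNorm R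
      _ ≤ ‖ω‖ := mul_le_of_le_one_right (norm_nonneg _) hR
  obtain ⟨n, hn⟩ := pow_unbounded_of_one_lt ((‖ω‖ - ω T) / (ω R₀ - ω T)) (one_lt_two)
  obtain ⟨R, hR, hR'⟩ := iter n
  rw [div_lt_iff₀ hδ'] at hn
  linarith [bound R hR]

/-- For projections `E`, `P`, the operator `1 - (E - P)²` commutes with both. -/
theorem IsStarProjection.commute_one_sub_sq_sub {E P : K →L[ℂ] K} (hE : IsStarProjection E)
    (hP : IsStarProjection P) :
    Commute E (1 - (E - P) * (E - P)) ∧ Commute P (1 - (E - P) * (E - P)) := by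
  have hEE : E * E = E := hE.isIdempotentElem
  have hPP : P * P = P := hP.isIdempotentElem
  have hEE' : ∀ x, E * (E * x) = E * x := fun x ↦ by rw [← mul_assoc, hEE]
  have hPP' : ∀ x, P * (P * x) = P * x := fun x ↦ by rw [← mul_assoc, hPP]
  constructor <;>
  · rw [commute_iff_eq]
    simp only [mul_sub, sub_mul, mul_one, one_mul, hEE, hPP, hEE', hPP', mul_assoc]
    abel

theorem IsStarProjection.one_sub_sq_sub_mem_Icc {E P : K →L[ℂ] K} (hE : IsStarProjection E)
    (hP : IsStarProjection P) :
    0 ≤ 1 - (E - P) * (E - P) ∧ 1 - (E - P) * (E - P) ≤ 1 := by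
  have hEE : E * E = E := hE.isIdempotentElem
  have hPP : P * P = P := hP.isIdempotentElem
  constructor
  · have : 1 - (E - P) * (E - P) = E * P * E + (1 - E) * (1 - P) * (1 - E) := by
      simp only [mul_sub, sub_mul, mul_one, one_mul, hEE, hPP]
      abel
    rw [this]
    exact add_nonneg (hE.isSelfAdjoint.conjugate_nonneg hP.nonneg)
      (hE.one_sub.isSelfAdjoint.conjugate_nonneg hP.one_sub.nonneg)
  · rw [sub_le_self_iff]
    exact (hE.isSelfAdjoint.sub hP.isSelfAdjoint).mul_self_nonneg

/-- The real linear functional `x ↦ Re ⟪v, x v⟫` on bounded operators. -/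
noncomputable def reVectorFunctional (v : K) : (K →L[ℂ] K) →L[ℝ] ℝ :=
  Complex.reCLM.comp
    (((innerSL ℂ v).comp (ContinuousLinearMap.apply ℂ K v)).restrictScalars ℝ)

theorem IsSelfAdjoint.re_inner_one_sub_mul_self {A : K →L[ℂ] K} (hA : IsSelfAdjoint A) (v : K) :
    (inner ℂ v ((1 - A * A) v)).re = ‖v‖ ^ 2 - ‖A v‖ ^ 2 := by
  have h := adjoint_inner_left A (A v) v
  rw [← star_eq_adjoint, hA.star_eq] at h
  change (inner ℂ v (v - A (A v))).re = _
  rw [inner_sub_right, ← h, inner_self_eq_norm_sq_to_K, inner_self_eq_norm_sq_to_K]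
  norm_cast

/-- Given a resolution of the identity `e` and a projection `P`, there is a projection `D`
commuting with every `e s`, in general position with respect to `P`, whose mass on the components
of a given vector is at least that of `P`. -/
theorem exists_isStarProjection_commute_resolution {ι : Type*} [Fintype ι] [DecidableEq ι]
    (e : ι → K →L[ℂ] K) (he : ∀ s, IsStarProjection (e s))
    (horth : ∀ s t, s ≠ t → e s * e t = 0) (hsum : ∑ s, e s = 1)
    (𝓐 : Set (K →L[ℂ] K)) (h𝓐 : ∀ A ∈ 𝓐, ∀ s, Commute A (e s)) (f : K) (F : Finset ι) :
    ∀ P : K →L[ℂ] K, IsStarProjection P → (∀ A ∈ 𝓐, Commute A P) → (∀ s ∉ F, P * e s = 0) →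
    ∃ D : K →L[ℂ] K, IsStarProjection D ∧ (∀ A ∈ 𝓐, Commute A D) ∧ (∀ s, Commute (e s) D) ∧
      (∀ s ∉ F, D * e s = 0) ∧ (∀ x, P x = x → D x = 0 → x = 0) ∧
      (∀ x, D x = x → P x = 0 → x = 0) ∧
      ∑ s, ‖P (e s f)‖ ^ 2 ≤ ∑ s, ‖D (e s f)‖ ^ 2 := by
  induction F using Finset.induction_on with
  | empty =>
    intro P hP _ h0
    have hP0 : P = 0 := by
      rw [← mul_one P, ← hsum, Finset.mul_sum]
      exact Finset.sum_eq_zero fun s _ ↦ h0 s (Finset.notMem_empty s)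
    subst hP0
    exact ⟨0, .zero _, fun A _ ↦ Commute.zero_right A, fun s ↦ Commute.zero_right _, by simp,
      fun x hx _ ↦ by simpa using hx.symm, fun x hx _ ↦ by simpa using hx.symm, le_rfl⟩
  | insert i F hi ih =>
    intro P hP hPA hP0
    set E := e i with hEdef
    have hE : IsStarProjection E := he i
    have hEE : E * E = E := hE.isIdempotentElem
    set T : K →L[ℂ] K := 1 - (E - P) * (E - P)
    obtain ⟨hT0, hT1⟩ := hE.one_sub_sq_sub_mem_Icc hP
    obtain ⟨hET, hPT⟩ := hE.commute_one_sub_sq_sub hP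
    have Tapp : ∀ v, T v = v - (E (E v - P v) - P (E v - P v)) := fun v ↦ rfl
    obtain ⟨Q, hQ, hQc, hQz, hQo, hω⟩ := exists_isStarProjection_ge hT0 hT1
      (reVectorFunctional (E f) - ∑ s ∈ Finset.univ.erase i, reVectorFunctional (e s f))
    have hEQ : E * Q = Q * E := (hQc E hET).eq
    have hPQ : P * Q = Q * P := (hQc P hPT).eq
    have hQQ : Q * Q = Q := hQ.isIdempotentElem
    have hEQ' : ∀ v, E (Q v) = Q (E v) := fun v ↦ DFunLike.congr_fun hEQ v
    have hPQ' : ∀ v, P (Q v) = Q (P v) := fun v ↦ DFunLike.congr_fun hPQ v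
    have hQQ' : ∀ v, Q (Q v) = Q v := fun v ↦ DFunLike.congr_fun hQQ v
    have hEE' : ∀ v, E (E v) = E v := fun v ↦ DFunLike.congr_fun hEE v
    have hP' : IsStarProjection ((1 - E) * (1 - Q)) :=
      hE.one_sub.mul hQ.one_sub
        ((Commute.one_left _).sub_left ((Commute.one_right E).sub_right hEQ))
    have hQA : ∀ A ∈ 𝓐, Commute A Q := by
      intro A hA
      have h1 : Commute A (E - P) := (h𝓐 A hA i).sub_right (hPA A hA)
      exact hQc A ((Commute.one_right A).sub_right (h1.mul_right h1))
    obtain ⟨D, hD, hDA, hDe, hD0, ha, hb, hc⟩ := ih ((1 - E) * (1 - Q)) hP'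
      (fun A hA ↦ ((Commute.one_right A).sub_right (h𝓐 A hA i)).mul_right
        ((Commute.one_right A).sub_right (hQA A hA)))
      (by
        intro s hs
        by_cases hsi : s = i
        · subst hsi
          rw [mul_assoc, sub_mul 1 Q, one_mul, ← hEdef, ← hEQ, sub_mul, mul_sub E, ← mul_assoc, hEE]
          simp
        · have h1 : P * e s = 0 := hP0 s (by simp [hs, hsi])
          have h2 : E * e s = 0 := horth i s (Ne.symm hsi)
          have h3 : Q * e s = e s := by
            ext v
            change Q (e s v) = e s v
            refine hQo (e s v) ?_
            have h1' : P (e s v) = 0 := DFunLike.congr_fun h1 v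
            have h2' : E (e s v) = 0 := DFunLike.congr_fun h2 v
            refine (Tapp _).trans ?_
            rw [h1', h2']
            simp
          rw [mul_assoc, sub_mul 1 Q, one_mul, h3, sub_self, mul_zero])
    have hDE : D * E = 0 := hD0 i hi
    have hED : E * D = 0 := (hDe i).eq.trans hDE
    have hDE' : ∀ v, D (E v) = 0 := fun v ↦ DFunLike.congr_fun hDE v
    have hED' : ∀ v, E (D v) = 0 := fun v ↦ DFunLike.congr_fun hED v
    have hEQp : IsStarProjection (E * Q) := hE.mul hQ hEQ
    have hnew : IsStarProjection (E * Q + D) := by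
      refine hEQp.add hD ?_
      rw [hEQ, mul_assoc, hED, mul_zero]
    have happ : ∀ v, (E * Q + D) v = E (Q v) + D v := fun v ↦ rfl
    have P'app : ∀ v, ((1 - E) * (1 - Q)) v = (v - Q v) - E (v - Q v) := fun v ↦ rfl
    refine ⟨E * Q + D, hnew, ?_, ?_, ?_, ?_, ?_, ?_⟩
    · exact fun A hA ↦ ((h𝓐 A hA i).mul_right (hQA A hA)).add_right (hDA A hA)
    · intro s
      refine Commute.add_right ?_ (hDe s)
      by_cases hsi : s = i
      · subst hsi
        exact (Commute.refl _).mul_right hEQ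
      · rw [commute_iff_eq, ← mul_assoc, horth s i hsi, hEQ, mul_assoc, horth i s (Ne.symm hsi)]
        simp
    · intro s hs
      rw [Finset.mem_insert, not_or] at hs
      rw [add_mul, hD0 s hs.2, hEQ, mul_assoc, horth i s (Ne.symm hs.1)]
      simp
    · intro x hPx hx
      rw [happ] at hx
      have h1 : E (Q x) = 0 := by
        have := congr_arg E hx
        rwa [map_add, hEE', hED', add_zero, map_zero] at this
      have h2 : D x = 0 := by rwa [h1, zero_add] at hx
      have h3 : Q x = 0 := by
        rw [← hQQ' x]
        apply hQz
        have : P (Q x) = Q x := by rw [hPQ', hPx]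
        refine (Tapp _).trans ?_
        simp [h1, this]
      have h4 : x - E x = 0 := by
        apply ha
        · rw [P'app, map_sub Q, ← hEQ', h3]
          simp [hEE']
        · rw [map_sub, h2, hDE', sub_zero]
      have h5 : E x = x := (sub_eq_zero.1 h4).symm
      rw [← hQo x ((Tapp _).trans (by simp [h5, hPx]))]
      exact h3
    · intro x hx hPx
      rw [happ] at hx
      have h1 : E (Q x) = E x := by
        have := congr_arg E hx
        rwa [map_add, hEE', hED', add_zero] at this
      have h2 : D x = x - E x := eq_sub_of_add_eq' (h1 ▸ hx)
      have h3 : x - Q x = 0 := by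
        have hE0 : E (x - Q x) = 0 := by rw [map_sub, h1, sub_self]
        have hP0' : P (x - Q x) = 0 := by rw [map_sub, hPQ', hPx, map_zero, sub_self]
        have := hQo (x - Q x) ((Tapp _).trans (by rw [hE0, hP0']; simp))
        rw [← this, map_sub, hQQ', sub_self]
      have h3' : Q x = x := (sub_eq_zero.1 h3).symm
      have h4 : x - E x = 0 := by
        apply hb
        · rw [map_sub, hDE', sub_zero, h2]
        · rw [P'app, map_sub Q, ← hEQ', h3']
          simp
      have h5 : E x = x := (sub_eq_zero.1 h4).symm
      rw [← h3']
      apply hQz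
      refine (Tapp _).trans ?_
      simp [h5, hPx]
    · have hTv : ∀ v, reVectorFunctional v T = ‖v‖ ^ 2 - ‖E v - P v‖ ^ 2 := fun v ↦
        (hE.isSelfAdjoint.sub hP.isSelfAdjoint).re_inner_one_sub_mul_self v
      have hQv : ∀ v, reVectorFunctional v Q = ‖Q v‖ ^ 2 := hQ.re_inner_apply_self
      have hfs : ∀ s ∈ Finset.univ.erase i, E (e s f) = 0 := fun s hs ↦
        DFunLike.congr_fun (horth i s (Finset.ne_of_mem_erase hs).symm) f
      rw [sub_apply, sub_apply, sum_apply, sum_apply, hTv, hQv, hEE', hP.norm_sub_apply_sq,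
        Finset.sum_congr rfl fun s _ ↦ hQv (e s f),
        Finset.sum_congr rfl (g := fun s ↦ ‖e s f‖ ^ 2 - ‖P (e s f)‖ ^ 2) fun s hs ↦ by
          rw [hTv, hfs s hs, zero_sub, norm_neg],
        Finset.sum_sub_distrib] at hω
      rw [← Finset.add_sum_erase _ _ (Finset.mem_univ i),
        ← Finset.add_sum_erase _ _ (Finset.mem_univ i), hDE', norm_zero,
        Finset.sum_congr rfl (g := fun s ↦ ‖e s f‖ ^ 2 - ‖Q (e s f)‖ ^ 2) fun s hs ↦ by
          rw [P'app, map_sub, hEQ', hfs s hs, map_zero, sub_zero, sub_zero,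
            hQ.norm_sub_apply_sq],
        Finset.sum_sub_distrib] at hc
      have hsumD : ∑ s ∈ Finset.univ.erase i, ‖(E * Q + D) (e s f)‖ ^ 2 =
          ∑ s ∈ Finset.univ.erase i, ‖D (e s f)‖ ^ 2 :=
        Finset.sum_congr rfl fun s hs ↦ by rw [happ, hEQ', hfs s hs, map_zero, zero_add]
      rw [← Finset.add_sum_erase _ (fun s ↦ ‖P (e s f)‖ ^ 2) (Finset.mem_univ i),
        ← Finset.add_sum_erase _ (fun s ↦ ‖(E * Q + D) (e s f)‖ ^ 2) (Finset.mem_univ i), hsumD]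
      have hi' : (E * Q + D) (e i f) = Q (E f) := by
        rw [happ, hEQ', hEE', hDE', add_zero]
      simp only [hi']
      have := sq_nonneg ‖((1 - E) * (1 - Q)) (E f)‖
      linarith

variable {H : Type*} [NormedAddCommGroup H] [InnerProductSpace ℂ H] [CompleteSpace H]

/-- If the projection `D` and the range of the isometry `V` are in general position, then `D` is
the range projection of an isometry `W` such that `V† W` is a positive contraction; it depends on
`D` naturally with respect to operators intertwined by `V`. -/
theorem exists_isometry_of_general_position {V : H →L[ℂ] K} (hV : adjoint V ∘L V = 1)
    {D : K →L[ℂ] K} (hD : IsStarProjection D) (ha : ∀ x, D (V x) = 0 → x = 0)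
    (hb : ∀ η, D η = η → adjoint V η = 0 → η = 0) :
    ∃ (W : H →L[ℂ] K) (C : H →L[ℂ] H), 0 ≤ C ∧ C ≤ 1 ∧ adjoint W ∘L W = 1 ∧
      W ∘L adjoint W = D ∧ adjoint V ∘L W = C ∧
      ∀ (m : H →L[ℂ] H) (m' : K →L[ℂ] K), V ∘L m = m' ∘L V → m ∘L adjoint V = adjoint V ∘L m' →
        Commute m' D → m' ∘L W = W ∘L m := by
  have hDD : ∀ η, D (D η) = D η := fun η ↦ DFunLike.congr_fun hD.isIdempotentElem.eq η
  have hDa : adjoint D = D := hD.isSelfAdjoint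
  have hDin : ∀ x y, inner ℂ (D x) y = inner ℂ x (D y) := fun x y ↦ by
    rw [← adjoint_inner_left, hDa]
  have hV' : ∀ x, adjoint V (V x) = x := fun x ↦ DFunLike.congr_fun hV x
  set B : H →L[ℂ] H := adjoint V ∘L D ∘L V with hB
  have hBapp : ∀ x, B x = adjoint V (D (V x)) := fun x ↦ rfl
  have hB0 : 0 ≤ B := by
    rw [nonneg_iff_isPositive]
    exact ((nonneg_iff_isPositive D).1 hD.nonneg).adjoint_conj V
  have hB1 : B ≤ 1 := by
    have h : 1 - B = adjoint V ∘L (1 - D) ∘L V := by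
      ext x
      change x - adjoint V (D (V x)) = adjoint V (V x - D (V x))
      rw [map_sub, hV']
    rw [← sub_nonneg, h, nonneg_iff_isPositive]
    exact ((nonneg_iff_isPositive (1 - D)).1 hD.one_sub.nonneg).adjoint_conj V
  set C := CFC.sqrt B with hC
  have hC0 : 0 ≤ C := CFC.sqrt_nonneg B
  have hCC : C * C = B := CFC.sqrt_mul_sqrt_self B hB0
  have hC1 : C ≤ 1 := by
    have := CFC.sqrt_le_sqrt B 1 hB1
    simpa using this
  have hCa : adjoint C = C := (IsSelfAdjoint.of_nonneg hC0)
  have hCC' : ∀ x, C (C x) = B x := fun x ↦ DFunLike.congr_fun hCC x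
  have hCin : ∀ x y, inner ℂ (C x) y = inner ℂ x (C y) := fun x y ↦ by
    rw [← adjoint_inner_left, hCa]
  have hCDV : ∀ x y, inner ℂ (C x) (C y) = inner ℂ (D (V x)) (D (V y)) := fun x y ↦ by
    rw [hCin, hCC', hBapp, adjoint_inner_right, hDin, hDD]
  have hCn : ∀ x, ‖(D ∘L V) x‖ = ‖C x‖ := fun x ↦ by
    have := hCDV x x
    rw [inner_self_eq_norm_sq_to_K, inner_self_eq_norm_sq_to_K] at this
    norm_cast at this
    exact ((sq_eq_sq₀ (norm_nonneg _) (norm_nonneg _)).1 this).symm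
  have hCinj : ∀ x, C x = 0 → x = 0 := fun x hx ↦ ha x (by
    rw [← norm_eq_zero]; exact (hCn x).trans (by rw [hx, norm_zero]))
  have hdense : DenseRange C := by
    have h : C.range.topologicalClosure = ⊤ := by
      rw [Submodule.topologicalClosure_eq_top_iff, orthogonal_range, hCa, Submodule.eq_bot_iff]
      exact hCinj
    rw [← Submodule.dense_iff_topologicalClosure_eq_top] at h
    exact h
  set W : H →L[ℂ] K := (D ∘L V).extendOfNorm C
  have hWC : ∀ x, W (C x) = D (V x) := fun x ↦
    LinearMap.extendOfNorm_eq hdense ⟨1, fun x ↦ by rw [one_mul]; exact (hCn x).le⟩ x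
  have hext : ∀ f g : H →L[ℂ] K, (∀ x, f (C x) = g (C x)) → f = g := fun f g h ↦
    DFunLike.coe_injective (hdense.equalizer f.continuous g.continuous (funext h))
  have hWn : ∀ x, ‖W x‖ = ‖x‖ := by
    intro x
    have h : (fun x ↦ ‖W x‖) = fun x ↦ ‖x‖ :=
      DenseRange.equalizer (f := C) hdense W.continuous.norm continuous_norm
        (funext fun x ↦ (congr_arg norm (hWC x)).trans (hCn x))
    exact congr_fun h x
  have hWW : adjoint W ∘L W = 1 := by
    exact W.norm_map_iff_adjoint_comp_self.1 hWn
  have hWW' : ∀ x, adjoint W (W x) = x := fun x ↦ DFunLike.congr_fun hWW x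
  have hDW : D ∘L W = W := hext _ _ fun x ↦ by
    change D (W (C x)) = _
    rw [hWC, hDD]
  have hCW : ∀ x, C (adjoint W x) = adjoint V (D x) := fun x ↦ by
    have : adjoint (W ∘L C) = adjoint (D ∘L V) := congr_arg adjoint (ContinuousLinearMap.ext hWC)
    rw [adjoint_comp, adjoint_comp, hCa, hDa] at this
    exact DFunLike.congr_fun this x
  refine ⟨W, C, hC0, hC1, hWW, ?_, ?_, ?_⟩
  · ext η
    change W (adjoint W η) = D η
    symm
    rw [← sub_eq_zero]
    have hDW' : ∀ x, D (W x) = W x := fun x ↦ DFunLike.congr_fun hDW x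
    apply hb
    · rw [map_sub, hDD, hDW']
    · rw [map_sub, ← hCW, ← hDW' (adjoint W η), ← hCW, hWW', sub_self]
  · have : adjoint W ∘L V = C := by
      ext x
      change adjoint W (V x) = C x
      rw [← sub_eq_zero]
      apply hCinj
      rw [map_sub, hCW, hCC', hBapp, sub_self]
    rw [← hCa, ← this, adjoint_comp, adjoint_adjoint]
  · intro m m' h1 h2 h3
    have h1' : ∀ x, V (m x) = m' (V x) := fun x ↦ DFunLike.congr_fun h1 x
    have h2' : ∀ x, m (adjoint V x) = adjoint V (m' x) := fun x ↦ DFunLike.congr_fun h2 x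
    have h3' : ∀ x, m' (D x) = D (m' x) := fun x ↦ DFunLike.congr_fun h3.eq x
    have hBm : Commute B m := by
      ext x
      change B (m x) = m (B x)
      rw [hBapp, hBapp, h1', h2', h3']
    have hCm : Commute C m := by
      rw [hC, CFC.sqrt]
      exact hBm.cfcₙ_nnreal _
    have hCm' : ∀ x, C (m x) = m (C x) := fun x ↦ DFunLike.congr_fun hCm.eq x
    refine hext _ _ fun x ↦ ?_
    change m' (W (C x)) = W (m (C x))
    rw [← hCm', hWC, hWC, h1', h3']

/-- If `V`, `W` are isometries with `V† W` a positive contraction, then `V† f` and `W† f` are close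
whenever both have almost the norm of `f`. -/
theorem norm_adjoint_sub_adjoint_sq_le {V W : H →L[ℂ] K} {C : H →L[ℂ] H}
    (hV : adjoint V ∘L V = 1) (hW : adjoint W ∘L W = 1) (hVW : adjoint V ∘L W = C)
    (hC0 : 0 ≤ C) (hC1 : C ≤ 1) (f : K) :
    ‖adjoint V f - adjoint W f‖ ^ 2 ≤
      2 * (‖f‖ ^ 2 - ‖adjoint V f‖ ^ 2) + 2 * (‖f‖ ^ 2 - ‖adjoint W f‖ ^ 2) := by
  have hV' : ∀ x, adjoint V (V x) = x := fun x ↦ DFunLike.congr_fun hV x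
  have hW' : ∀ x, adjoint W (W x) = x := fun x ↦ DFunLike.congr_fun hW x
  have hVW' : ∀ x, adjoint V (W x) = C x := fun x ↦ DFunLike.congr_fun hVW x
  have hWV : adjoint W ∘L V = C := by
    have h : adjoint C = C := IsSelfAdjoint.of_nonneg hC0
    rw [← h, ← hVW, adjoint_comp, adjoint_adjoint]
  have hWV' : ∀ x, adjoint W (V x) = C x := fun x ↦ DFunLike.congr_fun hWV x
  set p := adjoint V f + adjoint W f with hp
  set q := adjoint V f - adjoint W f with hq
  have key := parallelogram_law_with_norm ℂ (adjoint V f) (adjoint W f)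
  rw [← hp, ← hq] at key
  set g := (V + W) p with hg
  set l := (V - W) q with hl
  have hga : ∀ x, inner ℂ x g = inner ℂ (adjoint V x + adjoint W x) p := fun x ↦ by
    rw [hg, add_apply, inner_add_right, inner_add_left, adjoint_inner_left, adjoint_inner_left]
  have hla : ∀ x, inner ℂ x l = inner ℂ (adjoint V x - adjoint W x) q := fun x ↦ by
    rw [hl, sub_apply, inner_sub_right, inner_sub_left, adjoint_inner_left, adjoint_inner_left]
  have hfg : inner ℂ f g = (‖p‖ : ℂ) ^ 2 := by rw [hga, ← hp, inner_self_eq_norm_sq_to_K]; rfl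
  have hfl : inner ℂ f l = (‖q‖ : ℂ) ^ 2 := by rw [hla, ← hq, inner_self_eq_norm_sq_to_K]; rfl
  have hVg : adjoint V g = p + C p := by rw [hg, add_apply, map_add, hV', hVW']
  have hWg : adjoint W g = C p + p := by rw [hg, add_apply, map_add, hW', hWV']
  have hVl : adjoint V l = q - C q := by rw [hl, sub_apply, map_sub, hV', hVW']
  have hWl : adjoint W l = C q - q := by rw [hl, sub_apply, map_sub, hW', hWV']
  have hnorm : ∀ x : H, (inner ℂ x x).re = ‖x‖ ^ 2 := fun x ↦ by
    rw [inner_self_eq_norm_sq_to_K]; norm_cast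
  have hnorm' : ∀ x : K, (inner ℂ x x).re = ‖x‖ ^ 2 := fun x ↦ by
    rw [inner_self_eq_norm_sq_to_K]; norm_cast
  have hre : ∀ x, (inner ℂ (C x) x).re = (inner ℂ x (C x)).re := fun x ↦
    inner_re_symm (𝕜 := ℂ) (C x) x
  have hgl : inner ℂ g l = 0 := by
    rw [hla, hVg, hWg, add_comm, sub_self, inner_zero_left]
  have hgg : ‖g‖ ^ 2 ≤ 4 * ‖p‖ ^ 2 := by
    have h : (inner ℂ p (C p)).re ≤ (inner ℂ p p).re := re_inner_le_of_le hC1 p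
    rw [← hnorm', hga, hVg, hWg]
    simp only [inner_add_left, Complex.add_re, hre]
    rw [hnorm] at *
    linarith
  have hll : ‖l‖ ^ 2 ≤ 2 * ‖q‖ ^ 2 := by
    have h : (inner ℂ q ((0 : H →L[ℂ] H) q)).re ≤ (inner ℂ q (C q)).re := re_inner_le_of_le hC0 q
    rw [zero_apply, inner_zero_right, Complex.zero_re] at h
    rw [← hnorm', hla, hVl, hWl]
    simp only [inner_sub_left, Complex.sub_re, hre]
    rw [hnorm]
    linarith
  have hr := sq_nonneg ‖f - ((1 / 4 : ℂ) • g + (1 / 2 : ℂ) • l)‖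
  rw [norm_sub_sq (𝕜 := ℂ), norm_add_sq (𝕜 := ℂ), inner_add_right, inner_smul_right,
    inner_smul_right, inner_smul_right, inner_smul_left, hgl, hfg, hfl, norm_smul, norm_smul] at hr
  norm_num [← Complex.ofReal_pow] at hr
  nlinarith

theorem sum_norm_apply_sq {ι : Type*} [Fintype ι] {r : ι → K →L[ℂ] K}
    (hr : ∀ s, IsStarProjection (r s)) (hsum : ∑ s, r s = 1) (x : K) :
    ∑ s, ‖r s x‖ ^ 2 = ‖x‖ ^ 2 := by
  have h : ∑ s, inner ℂ x (r s x) = inner ℂ x x := by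
    rw [← inner_sum, ← sum_apply, hsum]
    rfl
  have h' : (inner ℂ x x).re = ‖x‖ ^ 2 := inner_self_eq_norm_sq (𝕜 := ℂ) x
  rw [← h', ← h, Complex.re_sum]
  exact Finset.sum_congr rfl fun s _ ↦ ((hr s).re_inner_apply_self x).symm

theorem norm_apply_of_adjoint_comp_self {V : H →L[ℂ] K} (hV : adjoint V ∘L V = 1) (x : H) :
    ‖V x‖ = ‖x‖ :=
  (norm_map_iff_adjoint_comp_self V).2 hV x

/-- A resolution of the identity compressed by an isometry `V` is close to a resolution of
the identity on the smaller space, in the seminorm of a vector `ξ`. -/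
theorem exists_resolution_norm_sub_sq_le {ι : Type*} [Fintype ι] {V : H →L[ℂ] K}
    (hV : adjoint V ∘L V = 1) (e : ι → K →L[ℂ] K) (he : ∀ s, IsStarProjection (e s))
    (horth : ∀ s t, s ≠ t → e s * e t = 0) (hsum : ∑ s, e s = 1)
    (𝓜 : Set ((H →L[ℂ] H) × (K →L[ℂ] K))) (hMV : ∀ m ∈ 𝓜, V ∘L m.1 = m.2 ∘L V)
    (hMV' : ∀ m ∈ 𝓜, m.1 ∘L adjoint V = adjoint V ∘L m.2)
    (hMe : ∀ m ∈ 𝓜, ∀ s, Commute m.2 (e s)) (ξ : H) :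
    ∃ q : ι → H →L[ℂ] H, (∀ s, IsStarProjection (q s)) ∧ ∑ s, q s = 1 ∧
      (∀ m ∈ 𝓜, ∀ s, Commute m.1 (q s)) ∧
      ∑ s, ‖adjoint V (e s (V ξ)) - q s ξ‖ ^ 2 ≤
        9 * (‖ξ‖ ^ 2 - ∑ s, ‖adjoint V (e s (V ξ))‖ ^ 2) := by
  classical
  have hV' : ∀ x, adjoint V (V x) = x := fun x ↦ DFunLike.congr_fun hV x
  set P : K →L[ℂ] K := V ∘L adjoint V with hPdef
  have hPapp : ∀ x, P x = V (adjoint V x) := fun x ↦ rfl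
  have hP : IsStarProjection P := by
    refine ⟨?_, ?_⟩
    · ext x
      change P (P x) = P x
      rw [hPapp, hPapp, hV']
    · rw [isSelfAdjoint_iff', hPdef, adjoint_comp, adjoint_adjoint]
  have hPn : ∀ x, ‖P x‖ = ‖adjoint V x‖ := fun x ↦ norm_apply_of_adjoint_comp_self hV _
  obtain ⟨D, hD, hDM, hDe, -, ha, hb, hle⟩ := exists_isStarProjection_commute_resolution e he horth
    hsum (Prod.snd '' 𝓜) (by rintro _ ⟨m, hm, rfl⟩; exact hMe m hm) (V ξ) Finset.univ P hP
    (by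
      rintro _ ⟨m, hm, rfl⟩
      change m.2 ∘L P = P ∘L m.2
      rw [hPdef, ← comp_assoc, ← hMV m hm, comp_assoc, hMV' m hm, comp_assoc])
    (fun s hs ↦ absurd (Finset.mem_univ s) hs)
  have hDM' : ∀ m ∈ 𝓜, Commute m.2 D := fun m hm ↦ hDM _ ⟨m, hm, rfl⟩
  obtain ⟨W, C, hC0, hC1, hW, hWD, hVW, hnat⟩ := exists_isometry_of_general_position hV hD
    (fun x hx ↦ by rw [← hV' x, ha (V x) (by rw [hPapp, hV']) hx, map_zero])
    (fun η hη h0 ↦ hb η hη (by rw [hPapp, h0, map_zero]))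
  have hW' : ∀ x, adjoint W (W x) = x := fun x ↦ DFunLike.congr_fun hW x
  have hWD' : ∀ x, W (adjoint W x) = D x := fun x ↦ DFunLike.congr_fun hWD x
  have hWDa : ∀ x, adjoint W (D x) = adjoint W x := fun x ↦ by rw [← hWD', hW']
  have hDn : ∀ x, ‖D x‖ = ‖adjoint W x‖ := fun x ↦ by
    rw [← hWD', norm_apply_of_adjoint_comp_self hW]
  have hCa : adjoint C = C := IsSelfAdjoint.of_nonneg hC0
  have hWV : ∀ x, adjoint W (V x) = C x := fun x ↦ by
    have : adjoint W ∘L V = C := by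
      rw [← hCa, ← hVW, adjoint_comp, adjoint_adjoint]
    exact DFunLike.congr_fun this x
  have hWC : ∀ x, W (C x) = D (V x) := fun x ↦ by rw [← hWV, hWD']
  have hee : ∀ s x, e s (e s x) = e s x := fun s x ↦
    DFunLike.congr_fun (he s).isIdempotentElem.eq x
  have hDe' : ∀ s x, e s (D x) = D (e s x) := fun s x ↦ DFunLike.congr_fun (hDe s).eq x
  have hsum' : ∀ x, ∑ s, e s x = x := fun x ↦ by
    have := DFunLike.congr_fun hsum x
    rwa [sum_apply] at this
  set q : ι → H →L[ℂ] H := fun s ↦ adjoint W ∘L e s ∘L W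
  have hqapp : ∀ s x, q s x = adjoint W (e s (W x)) := fun s x ↦ rfl
  have hqp : ∀ s, IsStarProjection (q s) := by
    intro s
    refine ⟨?_, ?_⟩
    · ext x
      change q s (q s x) = q s x
      rw [hqapp, hqapp, hWD', hDe', hWDa, hee]
    · rw [isSelfAdjoint_iff']
      change adjoint (adjoint W ∘L e s ∘L W) = _
      rw [adjoint_comp, adjoint_comp, adjoint_adjoint, (he s).isSelfAdjoint.adjoint_eq]
      rfl
  have hqsum : ∑ s, q s = 1 := by
    ext x
    simp only [sum_apply, hqapp]
    rw [← map_sum, hsum', hW']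
    rfl
  refine ⟨q, hqp, hqsum, ?_, ?_⟩
  · intro m hm s
    have h1 : ∀ x, m.2 (W x) = W (m.1 x) := fun x ↦
      DFunLike.congr_fun (hnat m.1 m.2 (hMV m hm) (hMV' m hm) (hDM' m hm)) x
    have h2 : adjoint m.2 ∘L W = W ∘L adjoint m.1 := by
      refine hnat _ _ ?_ ?_ ?_
      · have := congr_arg adjoint (hMV' m hm)
        rwa [adjoint_comp, adjoint_comp, adjoint_adjoint] at this
      · have := congr_arg adjoint (hMV m hm)
        rwa [adjoint_comp, adjoint_comp] at this
      · have := (hDM' m hm).star_star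
        rwa [hD.isSelfAdjoint.star_eq] at this
    have h3 : ∀ x, adjoint W (m.2 x) = m.1 (adjoint W x) := fun x ↦ by
      have := congr_arg adjoint h2
      rw [adjoint_comp, adjoint_comp, adjoint_adjoint, adjoint_adjoint] at this
      exact DFunLike.congr_fun this x
    ext x
    change m.1 (q s x) = q s (m.1 x)
    rw [hqapp, hqapp, ← h1, ← h3]
    congr 1
    exact DFunLike.congr_fun (hMe m hm s).eq (W x)
  · have hy : ∀ s, adjoint W (e s (V ξ)) = q s (C ξ) := fun s ↦ by
      rw [hqapp, hWC, hDe', hWDa]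
    have hDle : ∑ s, ‖adjoint V (e s (V ξ))‖ ^ 2 ≤ ∑ s, ‖adjoint W (e s (V ξ))‖ ^ 2 := by
      simpa only [hPn, hDn] using hle
    have hf : ∑ s, ‖e s (V ξ)‖ ^ 2 = ‖ξ‖ ^ 2 := by
      rw [sum_norm_apply_sq he hsum, norm_apply_of_adjoint_comp_self hV]
    have hx : ∑ s, ‖adjoint V (e s (V ξ)) - adjoint W (e s (V ξ))‖ ^ 2 ≤
        2 * (‖ξ‖ ^ 2 - ∑ s, ‖adjoint V (e s (V ξ))‖ ^ 2) +
          2 * (‖ξ‖ ^ 2 - ∑ s, ‖adjoint W (e s (V ξ))‖ ^ 2) := by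
      rw [← hf, ← Finset.sum_sub_distrib, ← Finset.sum_sub_distrib, Finset.mul_sum, Finset.mul_sum,
        ← Finset.sum_add_distrib]
      exact Finset.sum_le_sum fun s _ ↦ norm_adjoint_sub_adjoint_sq_le hV hW hVW hC0 hC1 _
    have hy2 : ∑ s, ‖adjoint W (e s (V ξ))‖ ^ 2 = ‖C ξ‖ ^ 2 := by
      simp only [hy]
      exact sum_norm_apply_sq hqp hqsum _
    have hz : ∑ s, ‖q s (C ξ) - q s ξ‖ ^ 2 ≤ ‖ξ‖ ^ 2 - ‖C ξ‖ ^ 2 := by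
      simp only [← map_sub]
      rw [sum_norm_apply_sq hqp hqsum, norm_sub_sq (𝕜 := ℂ)]
      have h1 : (inner ℂ ξ ((C * C) ξ)).re ≤ (inner ℂ ξ (C ξ)).re :=
        re_inner_le_of_le (by simpa [sq] using CStarAlgebra.pow_antitone hC0 hC1 one_le_two) ξ
      have h2 : inner ℂ ξ ((C * C) ξ) = inner ℂ (C ξ) (C ξ) := by
        rw [mul_apply_eq_comp, ← adjoint_inner_left, hCa]
      have h3 : (inner ℂ (C ξ) ξ).re = (inner ℂ ξ (C ξ)).re := inner_re_symm (𝕜 := ℂ) _ _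
      have h4 : (inner ℂ (C ξ) (C ξ)).re = ‖C ξ‖ ^ 2 := inner_self_eq_norm_sq (𝕜 := ℂ) _
      rw [h2, h4] at h1
      rw [RCLike.re_to_complex, h3]
      linarith
    have htri : ∀ u v : H, ‖u + v‖ ^ 2 ≤ 3 / 2 * ‖u‖ ^ 2 + 3 * ‖v‖ ^ 2 := by
      intro u v
      have := norm_add_le u v
      nlinarith [norm_nonneg (u + v), sq_nonneg (‖u‖ - 2 * ‖v‖)]
    calc ∑ s, ‖adjoint V (e s (V ξ)) - q s ξ‖ ^ 2
        ≤ ∑ s, (3 / 2 * ‖adjoint V (e s (V ξ)) - adjoint W (e s (V ξ))‖ ^ 2 +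
            3 * ‖q s (C ξ) - q s ξ‖ ^ 2) := by
          refine Finset.sum_le_sum fun s _ ↦ ?_
          have := htri (adjoint V (e s (V ξ)) - adjoint W (e s (V ξ))) (q s (C ξ) - q s ξ)
          rw [hy] at this ⊢
          rwa [sub_add_sub_cancel] at this
      _ = 3 / 2 * ∑ s, ‖adjoint V (e s (V ξ)) - adjoint W (e s (V ξ))‖ ^ 2 +
            3 * ∑ s, ‖q s (C ξ) - q s ξ‖ ^ 2 := by
          rw [Finset.sum_add_distrib, Finset.mul_sum, Finset.mul_sum]
      _ ≤ _ := by linarith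

end Rounding

section Dilation

open ContinuousLinearMap

variable {H : Type*} [NormedAddCommGroup H] [InnerProductSpace ℂ H] [CompleteSpace H]
  {S : Type*} [Fintype S]

/-- The inclusion of the summand at `s` in a finite Hilbert sum of copies of `H`. -/
noncomputable def piLpInclusion (s : S) : H →L[ℂ] PiLp 2 fun _ : S ↦ H :=
  adjoint (PiLp.proj 2 (fun _ : S ↦ H) s)

theorem adjoint_piLpInclusion_apply (s : S) (x : PiLp 2 fun _ : S ↦ H) :
    adjoint (piLpInclusion s) x = x s := by
  rw [piLpInclusion, adjoint_adjoint]
  rfl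

theorem piLpInclusion_apply [DecidableEq S] (s t : S) (x : H) :
    (piLpInclusion s x : PiLp 2 fun _ : S ↦ H) t = if t = s then x else 0 := by
  have : (piLpInclusion s x : PiLp 2 fun _ : S ↦ H) = PiLp.single 2 s x := by
    refine ext_inner_right ℂ fun y ↦ ?_
    rw [← adjoint_inner_right, adjoint_piLpInclusion_apply, PiLp.inner_apply,
      Finset.sum_eq_single s]
    · simp
    · intro t _ hts
      simp [hts]
    · simp
  rw [this]
  by_cases h : t = s
  · subst h; simp
  · simp [h]

theorem exists_pvm_of_povm (M : VonNeumannAlgebra H) (ξ : H) {a : S → H →L[ℂ] H}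
    (haM : ∀ s, a s ∈ M) (ha0 : ∀ s, 0 ≤ a s) (hasum : ∑ s, a s = 1) :
    ∃ q : S → H →L[ℂ] H, (∀ s, q s ∈ M) ∧ (∀ s, IsStarProjection (q s)) ∧ ∑ s, q s = 1 ∧
      ∑ s, ‖a s ξ - q s ξ‖ ^ 2 ≤ 9 * (‖ξ‖ ^ 2 - ∑ s, ‖a s ξ‖ ^ 2) := by
  classical
  have hJa := adjoint_piLpInclusion_apply (H := H) (S := S)
  have hJ := piLpInclusion_apply (H := H) (S := S)
  set J : S → H →L[ℂ] PiLp 2 fun _ : S ↦ H := piLpInclusion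
  have hbb : ∀ s x, CFC.sqrt (a s) (CFC.sqrt (a s) x) = a s x := fun s x ↦
    DFunLike.congr_fun (CFC.sqrt_mul_sqrt_self (a s) (ha0 s)) x
  have hba : ∀ s, adjoint (CFC.sqrt (a s)) = CFC.sqrt (a s) := fun s ↦
    IsSelfAdjoint.of_nonneg (CFC.sqrt_nonneg (a s))
  set b : S → H →L[ℂ] H := fun s ↦ CFC.sqrt (a s)
  set V : H →L[ℂ] PiLp 2 fun _ : S ↦ H := ∑ s, J s ∘L b s with hV
  have hVapp : ∀ x t, V x t = b t x := fun x t ↦ by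
    rw [hV, sum_apply]
    simp [hJ]
  have hVa : ∀ x, adjoint V x = ∑ s, b s (x s) := fun x ↦ by
    rw [hV, map_sum, sum_apply]
    refine Finset.sum_congr rfl fun s _ ↦ ?_
    rw [adjoint_comp, hba, comp_apply, hJa]
  set e : S → (PiLp 2 fun _ : S ↦ H) →L[ℂ] PiLp 2 fun _ : S ↦ H := fun s ↦ J s ∘L adjoint (J s)
    with he
  have heapp : ∀ s x t, e s x t = if t = s then x s else 0 := fun s x t ↦ by
    rw [he]
    simp only [comp_apply, hJ, hJa]
  let d : (H →L[ℂ] H) → (PiLp 2 fun _ : S ↦ H) →L[ℂ] PiLp 2 fun _ : S ↦ H :=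
    fun m ↦ ∑ s, J s ∘L m ∘L adjoint (J s)
  have hd : ∀ m x t, d m x t = m (x t) := fun m x t ↦ by
    simp only [d, sum_apply, comp_apply, hJa]
    simp [hJ]
  have hbm : ∀ m ∈ M.commutant, ∀ s x, b s (m x) = m (b s x) := by
    intro m hm s
    have h : Commute (a s) m := VonNeumannAlgebra.mem_commutant_iff.1 hm (a s) (haM s)
    have : Commute (CFC.sqrt (a s)) m := by
      rw [CFC.sqrt]
      exact h.cfcₙ_nnreal _
    exact fun x ↦ DFunLike.congr_fun this.eq x
  obtain ⟨q, hq, hqsum, hqm, hle⟩ := exists_resolution_norm_sub_sq_le (V := V)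
    (by
      ext x
      change adjoint V (V x) = x
      rw [hVa]
      simp only [hVapp, hbb, b]
      rw [← sum_apply, hasum]
      rfl) e
    (fun s ↦ ⟨by
      ext x t
      change e s (e s x) t = e s x t
      simp [heapp], by
      rw [isSelfAdjoint_iff', he]
      simp only [adjoint_comp, adjoint_adjoint]⟩)
    (fun s t hst ↦ by
      ext x u
      change e s (e t x) u = 0
      simp [heapp, hst])
    (by
      ext x t
      rw [sum_apply]
      simp [heapp])
    ((fun m ↦ (m, d m)) '' (M.commutant : Set (H →L[ℂ] H)))
    (by
      rintro _ ⟨m, hm, rfl⟩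
      ext x t
      change V (m x) t = d m (V x) t
      rw [hd, hVapp, hVapp, hbm m hm])
    (by
      rintro _ ⟨m, hm, rfl⟩
      ext x
      change m (adjoint V x) = adjoint V (d m x)
      rw [hVa, hVa, map_sum]
      exact Finset.sum_congr rfl fun s _ ↦ by rw [hd, hbm m hm])
    (by
      rintro _ ⟨m, hm, rfl⟩ s
      ext x t
      change d m (e s x) t = e s (d m x) t
      rw [hd, heapp, heapp, hd]
      split_ifs <;> simp)
    ξ
  have hVeV : ∀ s, adjoint V (e s (V ξ)) = a s ξ := fun s ↦ by
    rw [hVa, Finset.sum_eq_single s]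
    · rw [heapp, if_pos rfl, hVapp, hbb]
    · intro t _ hts
      rw [heapp, if_neg hts, map_zero]
    · simp
  simp only [hVeV] at hle
  refine ⟨q, fun s ↦ ?_, hq, hqsum, hle⟩
  rw [← M.commutant_commutant, VonNeumannAlgebra.mem_commutant_iff]
  exact fun m hm ↦ (hqm _ ⟨m, hm, rfl⟩ s).eq

end Dilation

/-- **de la Salle's rounding theorem.** Let `ρ` be the vector state of a
unit vector `ξ` on a von Neumann algebra `M ⊆ B(H)`.  If `{a s}` is a POVM in `M` with
`∑ s ρ(a s ²) ≥ 1 - ε`, then there is a PVM `{p s}` in `M` with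
`∑ s ρ((a s - p s)²) ≤ 9 ε`. -/
theorem povm_close_to_pvm_of_almost_projective
    {H : Type} [NormedAddCommGroup H] [InnerProductSpace ℂ H] [CompleteSpace H]
    (M : VonNeumannAlgebra H)
    (ξ : H) (hξ : ‖ξ‖ = 1)
    {S : Type} [Fintype S] [Nonempty S]
    (a : S → H →L[ℂ] H)
    (haM : ∀ s, a s ∈ M)
    (hapos : ∀ s, (a s).IsPositive)
    (hasum : ∑ s, a s = 1)
    (ε : ℝ) (hε : 0 ≤ ε)
    (h : 1 - ε ≤ (∑ s, @inner ℂ H _ ξ ((a s * a s) ξ)).re) :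
    ∃ q : S → H →L[ℂ] H,
      (∀ s, q s ∈ M) ∧
      (∀ s, IsSelfAdjoint (q s) ∧ q s * q s = q s) ∧
      (∑ s, q s = 1) ∧
      (∑ s, @inner ℂ H _ ξ (((a s - q s) * (a s - q s)) ξ)).re ≤ 9 * ε := by
  have hnorm : ∀ {x : H →L[ℂ] H}, IsSelfAdjoint x → (inner ℂ ξ ((x * x) ξ)).re = ‖x ξ‖ ^ 2 := by
    intro x hx
    rw [mul_apply_eq_comp, ← ContinuousLinearMap.adjoint_inner_left, hx.adjoint_eq,
      inner_self_eq_norm_sq_to_K]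
    norm_cast
  obtain ⟨q, hqM, hq, hqsum, hle⟩ := exists_pvm_of_povm M ξ haM
    (fun s ↦ (ContinuousLinearMap.nonneg_iff_isPositive _).2 (hapos s)) hasum
  refine ⟨q, hqM, fun s ↦ ⟨(hq s).isSelfAdjoint, (hq s).isIdempotentElem⟩, hqsum, ?_⟩
  rw [Complex.re_sum] at h ⊢
  simp only [hnorm (hapos _).isSelfAdjoint] at h
  simp only [hnorm ((hapos _).isSelfAdjoint.sub (hq _).isSelfAdjoint), sub_apply]
  rw [hξ] at hle
  linarith
end
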